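/- arXiv:1807.04196 — 5 statements merged into one kernel-verified Lean document; each statement's English description precedes it below -/
import Mathlib

section
/- A bisection (V₁,V₂) of a cubic graph G=(V,E) is orientable if and only if d(A) ≥ Δ(A) for every set of vertices A ⊆ V. -/
open Finset
open scoped Classical

namespace BEF

variable {V : Type*}

/-- An orientation of a simple graph: each edge gets exactly one direction. -/
structure Orientation (G : SimpleGraph V) where
  dir : V → V → Prop
  adj_of_dir : ∀ u v, dir u v → G.Adj u v
  dir_iff_not : ∀ u v, G.Adj u v → (dir u v ↔ ¬ dir v u)

/-- Net outflow (excess) of `f` at vertex `x` in orientation `D`. -/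
noncomputable def excess [Fintype V] {G : SimpleGraph V}
    (D : Orientation G) (f : Sym2 V → ℝ) (x : V) : ℝ :=
  (∑ y : V, if D.dir x y then f s(x, y) else 0)
    - (∑ y : V, if D.dir y x then f s(x, y) else 0)

/-- `f` is an `(r, α)`-bounded-excess flow in the orientation `D` of `G`. -/
def IsBEFlow [Fintype V] {G : SimpleGraph V}
    (D : Orientation G) (r α : ℝ) (f : Sym2 V → ℝ) : Prop :=
  (∀ e ∈ G.edgeSet, 1 ≤ f e ∧ f e ≤ r - 1) ∧ ∀ x : V, |excess D f x| ≤ α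

/-- `G` admits an `(r, α)`-flow. -/
def HasFlow [Fintype V] (G : SimpleGraph V) (r α : ℝ) : Prop :=
  ∃ D : Orientation G, ∃ f : Sym2 V → ℝ, IsBEFlow D r α f

/-- Outdegree of a vertex in an orientation. -/
noncomputable def outDeg {G : SimpleGraph V} (D : Orientation G) (x : V) : ℕ :=
  {y | D.dir x y}.ncard

/-- A cubic graph: every vertex has exactly 3 neighbours. -/
def IsCubic (G : SimpleGraph V) : Prop :=
  ∀ v : V, (G.neighborSet v).ncard = 3

/-- A bisection: a partition of the vertex set into two parts of equal size. -/
def IsBisection [Fintype V] (V₁ V₂ : Set V) : Prop :=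
  Disjoint V₁ V₂ ∧ V₁ ∪ V₂ = Set.univ ∧ V₁.ncard = V₂.ncard

/-- The bisection `(V₁, V₂)` of `G` is orientable. -/
def Orientable (G : SimpleGraph V) (V₁ V₂ : Set V) : Prop :=
  ∃ D : Orientation G, (∀ v ∈ V₁, outDeg D v = 1) ∧ (∀ v ∈ V₂, outDeg D v = 2)

/-- `d(A)`: the number of edges of `G` with exactly one endvertex in `A`. -/
noncomputable def cutCard (G : SimpleGraph V) (A : Set V) : ℕ :=
  {e ∈ G.edgeSet | ∃ u ∈ A, ∃ v ∉ A, e = s(u, v)}.ncard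

/-- `Δ(A) = | |V₂ ∩ A| - |V₁ ∩ A| |` (as an integer). -/
noncomputable def disc (V₁ V₂ A : Set V) : ℤ :=
  |((V₂ ∩ A).ncard : ℤ) - ((V₁ ∩ A).ncard : ℤ)|

/-- Every connected component of the subgraph induced on `S` is a tree on
at most `k - 2` vertices. -/
def WeakSide (G : SimpleGraph V) (k : ℕ) (S : Set V) : Prop :=
  (G.induce S).IsAcyclic ∧
    ∀ c : (G.induce S).ConnectedComponent, c.supp.ncard ≤ k - 2

/-- A `k`-weak bisection. -/
def KWeak [Fintype V] (G : SimpleGraph V) (k : ℕ) (V₁ V₂ : Set V) : Prop :=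
  IsBisection V₁ V₂ ∧ WeakSide G k V₁ ∧ WeakSide G k V₂

/-- A balanced orientation: every outdegree is 1 or 2. -/
def Balanced {G : SimpleGraph V} (D : Orientation G) : Prop :=
  ∀ v : V, outDeg D v = 1 ∨ outDeg D v = 2

/-- The edges of `G` meeting the vertex set `A`. -/
noncomputable def touching [Fintype V] (G : SimpleGraph V) (A : Finset V) : Finset (Sym2 V) :=
  {e ∈ G.edgeFinset | ∃ v ∈ A, v ∈ e}

lemma sum_outDeg_le_card_touching [Fintype V] {G : SimpleGraph V} (D : Orientation G)
    (A : Finset V) : ∑ v ∈ A, outDeg D v ≤ #(touching G A) := by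
  have h : ∑ v ∈ A, outDeg D v = #(A.sigma fun v => ({y | D.dir v y} : Finset V)) := by
    rw [Finset.card_sigma]
    refine Finset.sum_congr rfl fun v _ => ?_
    rw [outDeg, ← Set.ncard_coe_finset]
    simp
  rw [h]
  refine Finset.card_le_card_of_injOn (fun p => s(p.1, p.2)) ?_ ?_
  · rintro ⟨v, y⟩ hp
    simp only [Finset.coe_sigma, Set.mem_sigma_iff, Finset.mem_coe, Finset.mem_filter,
      Finset.mem_univ, true_and] at hp
    simp only [touching, Finset.coe_filter, SimpleGraph.mem_edgeFinset, Set.mem_ofPred_eq,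
      SimpleGraph.mem_edgeSet]
    exact ⟨D.adj_of_dir _ _ hp.2, v, hp.1, by simp⟩
  · rintro ⟨v, y⟩ hp ⟨v', y'⟩ hp' he
    simp only [Finset.coe_sigma, Set.mem_sigma_iff, Finset.mem_coe, Finset.mem_filter,
      Finset.mem_univ, true_and] at hp hp'
    rcases Sym2.eq_iff.1 he with ⟨rfl, rfl⟩ | ⟨rfl, rfl⟩
    · rfl
    · exact absurd hp'.2 ((D.dir_iff_not _ _ (D.adj_of_dir _ _ hp.2)).1 hp.2)

/-- Hakimi's criterion for orientations with prescribed outdegrees. -/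
lemma exists_orientation_of_sum_le [Fintype V] {G : SimpleGraph V} (w : V → ℕ)
    (htotal : ∑ v, w v = #G.edgeFinset)
    (hw : ∀ A : Finset V, ∑ v ∈ A, w v ≤ #(touching G A)) :
    ∃ D : Orientation G, ∀ v, outDeg D v = w v := by
  let t : (Σ v, Fin (w v)) → Finset (Sym2 V) := fun p => {e ∈ G.edgeFinset | p.1 ∈ e}
  obtain ⟨f, hf, hft⟩ := (Finset.all_card_le_biUnion_card_iff_exists_injective t).1 <| by
    intro S
    calc #S ≤ #((S.image Sigma.fst).sigma fun v => (Finset.univ : Finset (Fin (w v)))) := by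
          refine Finset.card_le_card fun p hp => ?_
          simpa using ⟨p.2, hp⟩
      _ = ∑ v ∈ S.image Sigma.fst, w v := by simp [Finset.card_sigma]
      _ ≤ #(touching G (S.image Sigma.fst)) := hw _
      _ ≤ #(S.biUnion t) := by
          refine Finset.card_le_card fun e he => ?_
          simp only [touching, Finset.mem_filter, Finset.mem_image] at he
          obtain ⟨he, v, ⟨p, hp, rfl⟩, hv⟩ := he
          exact Finset.mem_biUnion.2 ⟨p, hp, Finset.mem_filter.2 ⟨he, hv⟩⟩
  have hmem : ∀ p, p.1 ∈ f p := fun p => (Finset.mem_filter.1 (hft p)).2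
  have hedge : ∀ p, f p ∈ G.edgeFinset := fun p => (Finset.mem_filter.1 (hft p)).1
  have hsurj : ∀ e ∈ G.edgeFinset, ∃ p, f p = e := by
    have himage : Finset.univ.image f = G.edgeFinset := by
      refine Finset.eq_of_subset_of_card_le (fun e he => ?_) ?_
      · obtain ⟨p, -, rfl⟩ := Finset.mem_image.1 he
        exact hedge p
      · rw [Finset.card_image_of_injective _ hf, ← htotal]
        simp
    intro e he
    rw [← himage] at he
    simpa using he
  refine ⟨⟨fun u v => ∃ i, f ⟨u, i⟩ = s(u, v), ?_, ?_⟩, ?_⟩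
  · rintro u v ⟨i, hi⟩
    simpa [hi] using hedge ⟨u, i⟩
  · intro u v huv
    constructor
    · rintro ⟨i, hi⟩ ⟨j, hj⟩
      have := hf (hi.trans (Sym2.eq_swap.trans hj.symm))
      exact huv.ne (congrArg Sigma.fst this)
    · intro hnot
      obtain ⟨⟨x, i⟩, hi⟩ := hsurj s(u, v) (by simpa using huv)
      have hx := hmem ⟨x, i⟩
      rw [hi, Sym2.mem_iff] at hx
      rcases hx with rfl | rfl
      · exact ⟨i, hi⟩
      · exact absurd ⟨i, hi.trans Sym2.eq_swap⟩ hnot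
  · intro u
    choose g hg using fun i : Fin (w u) => Sym2.mem_iff_exists.1 (hmem ⟨u, i⟩)
    have hginj : Function.Injective g := by
      intro i j hij
      have := hf ((hg i).trans ((congrArg (fun y => s(u, y)) hij).trans (hg j).symm))
      simpa using this
    have hrange : {y | ∃ i, f ⟨u, i⟩ = s(u, y)} = Set.range g := by
      ext y
      refine exists_congr fun i => ?_
      rw [hg i, Sym2.congr_right]
    rw [outDeg]
    simp only [hrange]
    rw [← Set.image_univ, Set.ncard_image_of_injective _ hginj, Set.ncard_univ]
    simp

lemma IsCubic.degree_eq [Fintype V] {G : SimpleGraph V} (hG : IsCubic G) (v : V) :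
    G.degree v = 3 := by
  rw [← hG v, Set.ncard_eq_toFinset_card', ← SimpleGraph.card_neighborFinset_eq_degree]
  rfl

lemma two_mul_card_touching [Fintype V] {G : SimpleGraph V} (hG : IsCubic G) (A : Finset V) :
    2 * #(touching G A) = 3 * #A + cutCard G A := by
  have hcut : cutCard G A = #{e ∈ G.edgeFinset | ∃ u ∈ A, ∃ v ∉ A, e = s(u, v)} := by
    rw [cutCard, ← Set.ncard_coe_finset]
    simp
  have hdeg : 3 * #A = ∑ e ∈ G.edgeFinset, #{v ∈ A | v ∈ e} := by
    have hcount := Finset.sum_card_bipartiteAbove_eq_sum_card_bipartiteBelow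
      (s := A) (t := G.edgeFinset) (fun v e => v ∈ e)
    simp only [Finset.bipartiteAbove, Finset.bipartiteBelow] at hcount
    rw [← hcount, mul_comm, ← smul_eq_mul, ← Finset.sum_const]
    refine Finset.sum_congr rfl fun v _ => ?_
    rw [← SimpleGraph.incidenceFinset_eq_filter, SimpleGraph.card_incidenceFinset_eq_degree,
      hG.degree_eq]
  rw [hcut, hdeg, touching, Finset.card_filter, Finset.card_filter, Finset.mul_sum,
    ← Finset.sum_add_distrib]
  refine Finset.sum_congr rfl fun e he => ?_
  induction e with | _ x y
  have hxy : x ≠ y := (show G.Adj x y by simpa using he).ne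
  have hcard : #{v ∈ A | v ∈ s(x, y)} = (if x ∈ A then 1 else 0) + (if y ∈ A then 1 else 0) := by
    have : ({v ∈ A | v ∈ s(x, y)} : Finset V) = ({x, y} : Finset V).filter (· ∈ A) := by
      ext v
      simp [and_comm]
    rw [this, Finset.card_filter, Finset.sum_pair hxy]
  have htouch : (∃ v ∈ A, v ∈ s(x, y)) ↔ x ∈ A ∨ y ∈ A := by
    simp only [Sym2.mem_iff]
    grind
  have hcross : (∃ u ∈ A, ∃ v ∉ A, s(x, y) = s(u, v)) ↔
      (x ∈ A ∧ y ∉ A) ∨ (y ∈ A ∧ x ∉ A) := by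
    simp only [Sym2.eq_iff]
    grind
  simp only [hcard, htouch, hcross]
  by_cases hx : x ∈ A <;> by_cases hy : y ∈ A <;> simp [hx, hy]

lemma cutCard_compl (G : SimpleGraph V) (A : Set V) : cutCard G Aᶜ = cutCard G A := by
  unfold cutCard
  congr 1
  ext e
  simp only [Set.mem_ofPred_eq, Set.mem_compl_iff, not_not]
  refine and_congr_right fun _ => ⟨?_, ?_⟩ <;>
  · rintro ⟨u, hu, v, hv, rfl⟩
    exact ⟨v, hv, u, hu, Sym2.eq_swap⟩

/-- The outdegrees prescribed by a bisection with second part `V₂`. -/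
noncomputable def prescribed (V₂ : Set V) (v : V) : ℕ := if v ∈ V₂ then 2 else 1

lemma orientable_iff_prescribed [Fintype V] {G : SimpleGraph V} {V₁ V₂ : Set V}
    (hb : IsBisection V₁ V₂) :
    Orientable G V₁ V₂ ↔ ∃ D : Orientation G, ∀ v, outDeg D v = prescribed V₂ v := by
  obtain ⟨hdisj, hunion, -⟩ := hb
  refine exists_congr fun D => ⟨fun h v => ?_, fun h => ⟨fun v hv => ?_, fun v hv => ?_⟩⟩
  · by_cases hv : v ∈ V₂
    · simp [prescribed, hv, h.2 v hv]
    · have hv₁ : v ∈ V₁ :=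
        ((hunion ▸ Set.mem_univ v : v ∈ V₁ ∪ V₂)).resolve_right hv
      simp [prescribed, hv, h.1 v hv₁]
  · simp [h v, prescribed, Set.disjoint_left.1 hdisj hv]
  · simp [h v, prescribed, hv]

lemma card_eq_ncard_inter_add [Fintype V] {V₁ V₂ : Set V} (hb : IsBisection V₁ V₂)
    (A : Finset V) : #A = (V₁ ∩ A).ncard + (V₂ ∩ A).ncard := by
  rw [← Set.ncard_union_eq (hb.1.mono Set.inter_subset_left Set.inter_subset_left),
    ← Set.union_inter_distrib_right, hb.2.1, Set.univ_inter, Set.ncard_coe_finset]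

lemma sum_prescribed [Fintype V] {V₁ V₂ : Set V} (hb : IsBisection V₁ V₂) (A : Finset V) :
    ∑ v ∈ A, prescribed V₂ v = (V₁ ∩ A).ncard + 2 * (V₂ ∩ A).ncard := by
  have hsplit : ∀ v, prescribed V₂ v = 1 + if v ∈ V₂ then 1 else 0 := fun v => by
    by_cases hv : v ∈ V₂ <;> simp [prescribed, hv]
  have hfilter : #{v ∈ A | v ∈ V₂} = (V₂ ∩ A).ncard := by
    rw [← Set.ncard_coe_finset]
    congr 1
    ext v
    simp [and_comm]
  simp only [hsplit, Finset.sum_add_distrib, ← Finset.card_filter, hfilter]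
  rw [Finset.sum_const, smul_eq_mul, mul_one, card_eq_ncard_inter_add hb]
  ring

lemma sum_prescribed_le_iff [Fintype V] {G : SimpleGraph V} (hG : IsCubic G) {V₁ V₂ : Set V}
    (hb : IsBisection V₁ V₂) (A : Finset V) :
    ∑ v ∈ A, prescribed V₂ v ≤ #(touching G A) ↔
      ((V₂ ∩ A).ncard : ℤ) - (V₁ ∩ A).ncard ≤ cutCard G A := by
  have htouch := two_mul_card_touching hG A
  rw [card_eq_ncard_inter_add hb] at htouch
  rw [sum_prescribed hb]
  omega

lemma sum_prescribed_univ [Fintype V] {G : SimpleGraph V} (hG : IsCubic G) {V₁ V₂ : Set V}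
    (hb : IsBisection V₁ V₂) : ∑ v, prescribed V₂ v = #G.edgeFinset := by
  have hshake := G.sum_degrees_eq_twice_card_edges
  simp only [hG.degree_eq, Finset.sum_const, smul_eq_mul] at hshake
  rw [card_eq_ncard_inter_add hb] at hshake
  rw [sum_prescribed hb]
  have := hb.2.2
  simp only [Finset.coe_univ, Set.inter_univ] at hshake ⊢
  omega

/-- A bisection of a cubic graph is orientable iff `d(A) ≥ Δ(A)` for all `A`. -/
theorem stmt0 [Fintype V] (G : SimpleGraph V) (hG : IsCubic G)
    (V₁ V₂ : Set V) (hb : IsBisection V₁ V₂) :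
    Orientable G V₁ V₂ ↔ ∀ A : Set V, disc V₁ V₂ A ≤ (cutCard G A : ℤ) := by
  rw [orientable_iff_prescribed hb]
  constructor
  · rintro ⟨D, hD⟩ A
    have hle : ∀ B : Set V, ((V₂ ∩ B).ncard : ℤ) - (V₁ ∩ B).ncard ≤ cutCard G B := fun B => by
      have h := (sum_prescribed_le_iff hG hb B.toFinset).1 <| by
        simpa only [hD] using sum_outDeg_le_card_touching D B.toFinset
      simpa only [Set.coe_toFinset] using h
    have hA := hle A
    have hAc := hle Aᶜ
    rw [cutCard_compl] at hAc
    have h₁ := Set.ncard_inter_add_ncard_sdiff_eq_ncard V₁ A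
    have h₂ := Set.ncard_inter_add_ncard_sdiff_eq_ncard V₂ A
    rw [Set.sdiff_eq] at h₁ h₂
    have := hb.2.2
    rw [disc, abs_le]
    omega
  · intro h
    exact exists_orientation_of_sum_le _ (sum_prescribed_univ hG hb) fun A =>
      (sum_prescribed_le_iff hG hb A).2 ((le_abs_self _).trans (h A))

end BEF
end

section
/- A cubic graph G=(V,E) admits an (r,α)-flow, where r≥2 and 0≤α<3, if and only if there exists a bisection (V₁,V₂) of G such that: (1) for every subset A of V, d(A) ≥ Δ(A); and (2) for every nonempty subset A of V, α ≥ (2·d(A) − (d(A)−Δ(A))·r)/(2|A|). -/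
open Finset
open scoped Classical

namespace BEF

variable {V : Type*}

/-! ### Counting directed edges across a cut -/

lemma Orientation.not_dir_symm {G : SimpleGraph V} (D : Orientation G) {u v : V}
    (h : D.dir u v) : ¬ D.dir v u :=
  (D.dir_iff_not u v (D.adj_of_dir u v h)).1 h

/-- The total value of `f` on the directed edges leaving `A`. -/
noncomputable def outFlow [Fintype V] {G : SimpleGraph V} (D : Orientation G) (f : Sym2 V → ℝ)
    (A : Set V) : ℝ :=
  ∑ x : V, ∑ y : V, if D.dir x y ∧ x ∈ A ∧ y ∉ A then f s(x, y) else 0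

/-- The number of directed edges leaving `A`. -/
noncomputable def outCut [Fintype V] {G : SimpleGraph V} (D : Orientation G) (A : Set V) : ℝ :=
  outFlow D (fun _ => 1) A

lemma cutCard_eq_card [Fintype V] (G : SimpleGraph V) (A : Set V) :
    cutCard G A = #{p : V × V | G.Adj p.1 p.2 ∧ p.1 ∈ A ∧ p.2 ∉ A} := by
  unfold cutCard
  rw [← Set.ncard_coe_finset, ← Set.InjOn.ncard_image (f := fun p : V × V => s(p.1, p.2))]
  · congr 1
    ext e
    simp only [Set.mem_ofPred_eq, coe_filter, mem_univ, true_and, Set.mem_image, Prod.exists]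
    constructor
    · rintro ⟨he, u, hu, v, hv, rfl⟩
      exact ⟨u, v, ⟨he, hu, hv⟩, rfl⟩
    · rintro ⟨u, v, ⟨he, hu, hv⟩, rfl⟩
      exact ⟨he, u, hu, v, hv, rfl⟩
  · rintro ⟨a, b⟩ h ⟨c, d⟩ h' heq
    simp only [coe_filter, mem_univ, true_and, Set.mem_ofPred_eq] at h h'
    rcases Sym2.eq_iff.1 heq with ⟨rfl, rfl⟩ | ⟨rfl, rfl⟩
    · rfl
    · exact absurd h.2.1 h'.2.2

lemma cutCard_eq_outCut_add [Fintype V] {G : SimpleGraph V} (D : Orientation G) (A : Set V) :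
    (cutCard G A : ℝ) = outCut D A + outCut D Aᶜ := by
  have hswap : outCut D Aᶜ = ∑ x : V, ∑ y : V, if D.dir y x ∧ x ∈ A ∧ y ∉ A then 1 else 0 := by
    unfold outCut outFlow
    rw [Finset.sum_comm]
    refine sum_congr rfl fun x _ => sum_congr rfl fun y _ => ?_
    simp [and_comm]
  rw [hswap, cutCard_eq_card, Finset.card_filter, Fintype.sum_prod_type]
  push_cast
  unfold outCut outFlow
  simp only [← sum_add_distrib]
  refine sum_congr rfl fun x _ => sum_congr rfl fun y _ => ?_
  have h1 := D.adj_of_dir x y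
  have h2 := D.adj_of_dir y x
  have h3 := D.dir_iff_not x y
  by_cases ha : G.Adj x y
  · by_cases hd : D.dir x y
    · have := D.not_dir_symm hd
      simp [ha, hd, this]
    · have : D.dir y x := by_contra fun h => hd ((h3 ha).2 h)
      simp [ha, hd, this]
  · have hxy : ¬ D.dir x y := fun h => ha (h1 h)
    have hyx : ¬ D.dir y x := fun h => ha (h2 h).symm
    simp [ha, hxy, hyx]

lemma sum_mul_excess [Fintype V] {G : SimpleGraph V} (D : Orientation G) (f : Sym2 V → ℝ)
    (w : V → ℝ) :
    ∑ x, w x * excess D f x =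
      ∑ x, ∑ y, if D.dir x y then f s(x, y) * (w x - w y) else 0 := by
  have hswap : ∑ x, w x * ∑ y, (if D.dir y x then f s(x, y) else 0) =
      ∑ x, ∑ y, if D.dir x y then f s(x, y) * w y else 0 := by
    simp only [mul_sum]
    rw [Finset.sum_comm]
    refine sum_congr rfl fun x _ => sum_congr rfl fun y _ => ?_
    rw [Sym2.eq_swap]
    split_ifs <;> ring
  unfold excess
  simp only [mul_sub, sum_sub_distrib]
  rw [hswap]
  simp only [mul_sum, ← sum_sub_distrib]
  refine sum_congr rfl fun x _ => sum_congr rfl fun y _ => ?_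
  split_ifs <;> ring

lemma sum_mem_excess [Fintype V] {G : SimpleGraph V} (D : Orientation G) (f : Sym2 V → ℝ)
    (A : Set V) :
    ∑ x, (if x ∈ A then excess D f x else 0) =
      outFlow D f A - outFlow D f Aᶜ := by
  have h := sum_mul_excess D f (fun x => if x ∈ A then 1 else 0)
  simp only [ite_mul, one_mul, zero_mul] at h
  rw [h]
  simp only [outFlow, ← sum_sub_distrib]
  refine sum_congr rfl fun x _ => sum_congr rfl fun y _ => ?_
  by_cases hd : D.dir x y <;> by_cases hx : x ∈ A <;> by_cases hy : y ∈ A <;> simp [hd, hx, hy]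

lemma outDeg_eq_sum [Fintype V] {G : SimpleGraph V} (D : Orientation G) (x : V) :
    (outDeg D x : ℝ) = ∑ y, if D.dir x y then 1 else 0 := by
  unfold outDeg
  rw [Set.ncard_eq_toFinset_card', Set.toFinset_ofPred, Finset.card_filter]
  push_cast
  rfl

lemma excess_one [Fintype V] {G : SimpleGraph V} (hG : IsCubic G) (D : Orientation G) (x : V) :
    excess D (fun _ => 1) x = 2 * outDeg D x - 3 := by
  have h3 : ∑ y, (if D.dir x y then (1 : ℝ) else 0) + ∑ y, (if D.dir y x then (1 : ℝ) else 0)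
      = 3 := by
    have h := hG x
    rw [Set.ncard_eq_toFinset_card', ← SimpleGraph.neighborFinset_def,
      SimpleGraph.neighborFinset_eq_filter, Finset.card_filter] at h
    have h' : ((∑ y, if G.Adj x y then 1 else 0 : ℕ) : ℝ) = 3 := by exact_mod_cast h
    push_cast at h'
    rw [← h', ← sum_add_distrib]
    refine sum_congr rfl fun y _ => ?_
    by_cases ha : G.Adj x y
    · have := D.dir_iff_not x y ha
      by_cases hd : D.dir y x <;> simp_all
    · have hxy : ¬ D.dir x y := fun h => ha (D.adj_of_dir _ _ h)
      have hyx : ¬ D.dir y x := fun h => ha (D.adj_of_dir _ _ h).symm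
      simp [ha, hxy, hyx]
  unfold excess
  rw [outDeg_eq_sum]
  linarith

lemma ncard_inter_eq_sum [Fintype V] (S A : Set V) :
    ((S ∩ A).ncard : ℝ) = ∑ x, if x ∈ A then (if x ∈ S then 1 else 0) else 0 := by
  rw [Set.ncard_eq_toFinset_card', Set.toFinset_inter]
  have : S.toFinset ∩ A.toFinset = ({x | x ∈ A ∧ x ∈ S} : Finset V) := by ext; simp [and_comm]
  rw [this, Finset.card_filter]
  push_cast
  refine sum_congr rfl fun x _ => ?_
  by_cases x ∈ A <;> simp_all

/-- In an orientation with outdegree one on `V₁` and two on `V₂`, the discrepancy of `A` is the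
difference between the numbers of edges leaving and entering `A`. -/
lemma ncard_sub_ncard_eq_outCut_sub [Fintype V] {G : SimpleGraph V} (hG : IsCubic G)
    (D : Orientation G) {V₁ V₂ : Set V} (hdisj : Disjoint V₁ V₂) (hunion : V₁ ∪ V₂ = Set.univ)
    (h₁ : ∀ v ∈ V₁, outDeg D v = 1) (h₂ : ∀ v ∈ V₂, outDeg D v = 2) (A : Set V) :
    ((V₂ ∩ A).ncard : ℝ) - ((V₁ ∩ A).ncard : ℝ) = outCut D A - outCut D Aᶜ := by
  have h := sum_mem_excess D (fun _ => 1) A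
  unfold outCut
  rw [← h, ncard_inter_eq_sum, ncard_inter_eq_sum, ← sum_sub_distrib]
  refine sum_congr rfl fun x _ => ?_
  rw [excess_one hG]
  have hx : x ∈ V₁ ∪ V₂ := hunion ▸ Set.mem_univ x
  by_cases hA : x ∈ A
  · rcases hx with hx | hx
    · have hx' : x ∉ V₂ := fun h => Set.disjoint_left.1 hdisj hx h
      simp only [hA, hx, hx', h₁ x hx]; norm_num
    · have hx' : x ∉ V₁ := fun h => Set.disjoint_left.1 hdisj h hx
      simp only [hA, hx, hx', h₂ x hx]; norm_num
  · simp [hA]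

lemma outCut_nonneg [Fintype V] {G : SimpleGraph V} (D : Orientation G) (A : Set V) :
    0 ≤ outCut D A :=
  sum_nonneg fun _ _ => sum_nonneg fun _ _ => by split_ifs <;> norm_num

/-! ### From flows to bisections -/

lemma sum_excess_bounds [Fintype V] {G : SimpleGraph V} (D : Orientation G) {r α : ℝ}
    {f : Sym2 V → ℝ} (hf : IsBEFlow D r α f) (A : Set V) :
    outCut D A - (r - 1) * outCut D Aᶜ ≤ α * A.ncard ∧
      outCut D Aᶜ - (r - 1) * outCut D A ≤ α * A.ncard := by
  have hcard : α * A.ncard = ∑ x, if x ∈ A then α else 0 := by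
    have := ncard_inter_eq_sum Set.univ A
    rw [Set.univ_inter] at this
    rw [this, mul_sum]
    refine sum_congr rfl fun x _ => ?_
    simp
  have hlow : ∀ B : Set V, outCut D B ≤ outFlow D f B := fun B =>
    sum_le_sum fun x _ => sum_le_sum fun y _ => by
      split_ifs with h
      · exact (hf.1 s(x, y) (D.adj_of_dir x y h.1)).1
      · exact le_rfl
  have hupp : ∀ B : Set V, outFlow D f B ≤ (r - 1) * outCut D B := fun B => by
    unfold outCut outFlow
    simp only [mul_sum]
    refine sum_le_sum fun x _ => sum_le_sum fun y _ => ?_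
    split_ifs with h
    · rw [mul_one]
      exact (hf.1 s(x, y) (D.adj_of_dir x y h.1)).2
    · simp
  have hexc := sum_mem_excess D f A
  have hle : ∑ x, (if x ∈ A then excess D f x else 0) ≤ ∑ x, if x ∈ A then α else 0 :=
    sum_le_sum fun x _ => by
      split_ifs
      · exact (abs_le.1 (hf.2 x)).2
      · exact le_rfl
  have hge : -∑ x, (if x ∈ A then α else 0) ≤ ∑ x, if x ∈ A then excess D f x else 0 := by
    rw [← sum_neg_distrib]
    refine sum_le_sum fun x _ => ?_
    split_ifs
    · exact (abs_le.1 (hf.2 x)).1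
    · simp
  rw [hcard]
  have := hlow A
  have := hlow Aᶜ
  have := hupp A
  have := hupp Aᶜ
  constructor <;> linarith

lemma outDeg_eq_one_or_two [Fintype V] {G : SimpleGraph V} (hG : IsCubic G) (D : Orientation G)
    {r α : ℝ} (hα3 : α < 3) {f : Sym2 V → ℝ} (hf : IsBEFlow D r α f) (x : V) :
    outDeg D x = 1 ∨ outDeg D x = 2 := by
  have hexc := abs_le.1 (hf.2 x)
  have hone := excess_one hG D x
  have hout := outDeg_eq_sum D x
  have hin : ∑ y, (if D.dir y x then (1 : ℝ) else 0) = 3 - outDeg D x := by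
    unfold excess at hone
    linarith
  have hle : ∑ y, (if D.dir y x then (1 : ℝ) else 0) ≤
      ∑ y, if D.dir y x then f s(x, y) else 0 :=
    sum_le_sum fun y _ => by
      split_ifs with h
      · exact (hf.1 s(x, y) (D.adj_of_dir y x h).symm).1
      · exact le_rfl
  have hle' : ∑ y, (if D.dir x y then (1 : ℝ) else 0) ≤
      ∑ y, if D.dir x y then f s(x, y) else 0 :=
    sum_le_sum fun y _ => by
      split_ifs with h
      · exact (hf.1 s(x, y) (D.adj_of_dir x y h)).1
      · exact le_rfl
  have hin0 : 0 ≤ ∑ y, (if D.dir y x then (1 : ℝ) else 0) :=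
    sum_nonneg fun _ _ => by split_ifs <;> norm_num
  have hle3 : outDeg D x ≤ 3 := by
    have : (outDeg D x : ℝ) ≤ 3 := by linarith
    exact_mod_cast this
  have key : outDeg D x ≠ 0 ∧ outDeg D x ≠ 3 := by
    constructor <;> intro h
    · have hz : ∑ y, (if D.dir x y then f s(x, y) else 0) = 0 := by
        refine sum_eq_zero fun y _ => if_neg fun hd => ?_
        rw [outDeg, Set.ncard_eq_zero] at h
        exact Set.eq_empty_iff_forall_notMem.1 h y hd
      unfold excess at hexc
      rw [h] at hin
      push_cast at hin
      linarith [hexc.1]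
    · have hz : ∑ y, (if D.dir y x then f s(x, y) else 0) = 0 := by
        refine sum_eq_zero fun y _ => if_neg fun hd => ?_
        rw [h] at hin
        have hpos : (0 : ℝ) < ∑ y, (if D.dir y x then (1 : ℝ) else 0) :=
          sum_pos' (fun _ _ => by split_ifs <;> norm_num) ⟨y, mem_univ y, by simp [hd]⟩
        push_cast at hin
        linarith
      unfold excess at hexc
      rw [h] at hout
      push_cast at hout
      linarith [hexc.2]
  omega

lemma disc_cast (V₁ V₂ A : Set V) :
    (disc V₁ V₂ A : ℝ) = |((V₂ ∩ A).ncard : ℝ) - ((V₁ ∩ A).ncard : ℝ)| := by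
  simp [disc]

lemma exists_bisection_of_hasFlow [Fintype V] {G : SimpleGraph V} (hG : IsCubic G) {r α : ℝ}
    (hα3 : α < 3) (h : HasFlow G r α) :
    ∃ V₁ V₂ : Set V, IsBisection V₁ V₂ ∧
      (∀ A : Set V, disc V₁ V₂ A ≤ (cutCard G A : ℤ)) ∧
      (∀ A : Set V, A.Nonempty →
        (2 * (cutCard G A : ℝ) - ((cutCard G A : ℝ) - (disc V₁ V₂ A : ℝ)) * r)
          / (2 * (A.ncard : ℝ)) ≤ α) := by
  obtain ⟨D, f, hf⟩ := h
  have hdisj : Disjoint {v | outDeg D v = 1} {v | outDeg D v = 2} :=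
    Set.disjoint_left.2 fun v hv hv' => by
      simp only [Set.mem_ofPred_eq] at hv hv'
      omega
  have hunion : {v | outDeg D v = 1} ∪ {v | outDeg D v = 2} = Set.univ :=
    Set.eq_univ_of_forall fun v => outDeg_eq_one_or_two hG D hα3 hf v
  have hdisc := ncard_sub_ncard_eq_outCut_sub hG D hdisj hunion (fun _ h => h) (fun _ h => h)
  refine ⟨{v | outDeg D v = 1}, {v | outDeg D v = 2}, ⟨hdisj, hunion, ?_⟩, fun A => ?_,
    fun A hA => ?_⟩
  · have := hdisc Set.univ
    simp only [Set.inter_univ, outCut, outFlow, Set.compl_univ, Set.mem_univ, Set.mem_empty_iff_false,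
      not_true_eq_false, and_false, false_and, if_false, sum_const_zero, sub_self] at this
    have h' : (({v | outDeg D v = 1} : Set V).ncard : ℝ) =
        ({v | outDeg D v = 2} : Set V).ncard := by
      linarith
    exact_mod_cast h'
  · have : (disc {v | outDeg D v = 1} {v | outDeg D v = 2} A : ℝ) ≤ cutCard G A := by
      rw [disc_cast, hdisc, cutCard_eq_outCut_add D]
      have := outCut_nonneg D A
      have := outCut_nonneg D Aᶜ
      exact abs_le.2 ⟨by linarith, by linarith⟩
    exact_mod_cast this
  · have hpos : (0 : ℝ) < A.ncard := by
      exact_mod_cast (Set.ncard_pos).2 hA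
    rw [div_le_iff₀ (by positivity), disc_cast, hdisc, cutCard_eq_outCut_add D]
    obtain ⟨h1, h2⟩ := sum_excess_bounds D hf A
    rcases abs_cases (outCut D A - outCut D Aᶜ) with ⟨h, -⟩ | ⟨h, -⟩ <;> rw [h] <;> linarith

/-! ### Orientations with prescribed outdegrees -/

lemma two_mul_card_edges_touching [Fintype V] {G : SimpleGraph V} (hG : IsCubic G)
    (T : Finset V) :
    3 * #T + cutCard G T ≤ 2 * #(T.biUnion fun x => G.incidenceFinset x) := by
  have hsplit : #({p : V × V | G.Adj p.1 p.2 ∧ (p.1 ∈ T ∨ p.2 ∈ T)} : Finset (V × V)) =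
      3 * #T + cutCard G T := by
    have hdeg : #({p : V × V | G.Adj p.1 p.2 ∧ p.2 ∈ T} : Finset (V × V)) = 3 * #T := by
      rw [Finset.card_filter, Fintype.sum_prod_type, Finset.sum_comm]
      have : ∀ y, (∑ x, if G.Adj x y ∧ y ∈ T then 1 else 0) = if y ∈ T then 3 else 0 := by
        intro y
        have h := hG y
        rw [Set.ncard_eq_toFinset_card', ← SimpleGraph.neighborFinset_def,
          SimpleGraph.neighborFinset_eq_filter, Finset.card_filter] at h
        by_cases hy : y ∈ T
        · simpa [hy, G.adj_comm] using h
        · simp [hy]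
      simp only [this, sum_ite_mem, univ_inter, sum_const, smul_eq_mul, mul_comm]
    rw [← hdeg, cutCard_eq_card, ← card_union_of_disjoint]
    · congr 1
      ext ⟨x, y⟩
      simp only [mem_filter, mem_univ, true_and, mem_union, mem_coe]
      tauto
    · rw [Finset.disjoint_left]
      rintro ⟨x, y⟩ h h'
      simp only [mem_filter, mem_univ, true_and, mem_coe] at h h'
      exact h'.2.2 h.2
  rw [← hsplit]
  refine card_le_mul_card_image_of_maps_to (f := fun p : V × V => s(p.1, p.2)) ?_ 2 ?_
  · rintro ⟨x, y⟩ h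
    simp only [mem_filter, mem_univ, true_and] at h
    simp only [mem_biUnion, SimpleGraph.mem_incidenceFinset]
    rcases h with ⟨ha, hx | hy⟩
    · exact ⟨x, hx, ha, Sym2.mem_mk_left x y⟩
    · exact ⟨y, hy, ha, Sym2.mem_mk_right x y⟩
  · intro e _
    induction e with | _ a b =>
    refine (card_le_card (t := {(a, b), (b, a)}) ?_).trans card_le_two
    rintro ⟨x, y⟩ h
    simp only [mem_filter] at h
    rcases Sym2.eq_iff.1 h.2 with ⟨rfl, rfl⟩ | ⟨rfl, rfl⟩ <;> simp

lemma orientable_of_disc_le [Fintype V] {G : SimpleGraph V} (hG : IsCubic G) {V₁ V₂ : Set V}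
    (hb : IsBisection V₁ V₂) (hd : ∀ A : Set V, disc V₁ V₂ A ≤ (cutCard G A : ℤ)) :
    Orientable G V₁ V₂ := by
  obtain ⟨hdisj, hunion, hcard⟩ := hb
  let o : V → ℕ := fun x => if x ∈ V₂ then 2 else 1
  have ho : ∀ T : Finset V, 2 * ((∑ x ∈ T, o x : ℕ) : ℤ) =
      3 * #T + (((V₂ ∩ T).ncard : ℤ) - ((V₁ ∩ T).ncard : ℤ)) := by
    intro T
    suffices h : (2 * ((∑ x ∈ T, o x : ℕ) : ℝ)) =
        3 * #T + (((V₂ ∩ T).ncard : ℝ) - ((V₁ ∩ T).ncard : ℝ)) by exact_mod_cast h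
    rw [ncard_inter_eq_sum, ncard_inter_eq_sum]
    simp only [mem_coe, sum_ite_mem, univ_inter]
    rw [← sum_sub_distrib, Finset.card_eq_sum_ones]
    push_cast
    rw [mul_sum, mul_sum, ← sum_add_distrib]
    refine sum_congr rfl fun x _ => ?_
    have hx : x ∈ V₁ ∪ V₂ := hunion ▸ Set.mem_univ x
    rcases hx with hx | hx
    · have hx' : x ∉ V₂ := fun h => Set.disjoint_left.1 hdisj hx h
      simp only [o, hx, hx']; norm_num
    · have hx' : x ∉ V₁ := fun h => Set.disjoint_left.1 hdisj h hx
      simp only [o, hx, hx']; norm_num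
  have hHall : ∀ X : Finset (Σ x : V, Fin (o x)),
      #X ≤ #(X.biUnion fun p => G.incidenceFinset p.1) := by
    intro X
    have hX : #X ≤ ∑ x ∈ X.image Sigma.fst, o x := by
      calc #X ≤ #((X.image Sigma.fst).sigma fun x => (univ : Finset (Fin (o x)))) :=
            card_le_card fun p hp => by
              simpa using ⟨p.2, hp⟩
        _ = _ := by simp
    have himg : (X.biUnion fun p => G.incidenceFinset p.1) =
        (X.image Sigma.fst).biUnion fun x => G.incidenceFinset x := by
      rw [image_biUnion]
    rw [himg]
    have h1 := ho (X.image Sigma.fst)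
    have h2 := (le_abs_self _).trans (hd (X.image Sigma.fst : Finset V))
    have h3 := two_mul_card_edges_touching hG (X.image Sigma.fst)
    omega
  obtain ⟨φ, hφ, hmem⟩ := (all_card_le_biUnion_card_iff_exists_injective _).1 hHall
  have hinc : ∀ x i, φ ⟨x, i⟩ ∈ G.edgeSet ∧ x ∈ φ ⟨x, i⟩ := fun x i => by
    simpa [SimpleGraph.incidenceSet] using hmem ⟨x, i⟩
  have hsurj : ∀ e ∈ G.edgeSet, ∃ p, φ p = e := by
    have himage : univ.image φ = G.edgeFinset := by
      refine eq_of_subset_of_card_le (fun e he => ?_) ?_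
      · obtain ⟨⟨x, i⟩, -, rfl⟩ := mem_image.1 he
        exact SimpleGraph.mem_edgeFinset.2 (hinc x i).1
      · rw [card_image_of_injective _ hφ, card_univ, Fintype.card_sigma]
        simp only [Fintype.card_fin]
        have h1 := ho univ
        have h2 := G.sum_degrees_eq_twice_card_edges
        have h3 : ∀ v, G.degree v = 3 := fun v => by
          rw [← hG v, Set.ncard_eq_toFinset_card', ← SimpleGraph.neighborFinset_def,
            SimpleGraph.card_neighborFinset_eq_degree]
        simp only [h3, sum_const, smul_eq_mul] at h2
        simp only [coe_univ, Set.inter_univ, hcard] at h1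
        omega
    intro e he
    have : e ∈ univ.image φ := himage ▸ SimpleGraph.mem_edgeFinset.2 he
    obtain ⟨p, -, hp⟩ := mem_image.1 this
    exact ⟨p, hp⟩
  let D : Orientation G :=
    { dir := fun x y => ∃ i, φ ⟨x, i⟩ = s(x, y)
      adj_of_dir := by
        rintro u v ⟨i, hi⟩
        have := (hinc u i).1
        rwa [hi] at this
      dir_iff_not := by
        intro u v huv
        constructor
        · rintro ⟨i, hi⟩ ⟨j, hj⟩
          have := hφ (hi.trans (Sym2.eq_swap.trans hj.symm))
          exact huv.ne (congrArg Sigma.fst this)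
        · intro hn
          obtain ⟨⟨z, i⟩, hz⟩ := hsurj s(u, v) huv
          have hzm := (hinc z i).2
          rw [hz, Sym2.mem_iff] at hzm
          rcases hzm with rfl | rfl
          · exact ⟨i, hz⟩
          · exact absurd ⟨i, hz.trans Sym2.eq_swap⟩ hn }
  have hout : ∀ x, outDeg D x = o x := by
    intro x
    choose y hy using fun i => Sym2.mem_iff_exists.1 (hinc x i).2
    have hset : {z | D.dir x z} = Set.range y := by
      ext z
      constructor
      · rintro ⟨i, hi⟩
        exact ⟨i, Sym2.congr_right.1 ((hy i).symm.trans hi)⟩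
      · rintro ⟨i, rfl⟩
        exact ⟨i, hy i⟩
    have hinj : Function.Injective y := fun i j hij => by
      have := hφ ((hy i).trans ((congrArg (fun z => s(x, z)) hij).trans (hy j).symm))
      simpa using this
    rw [outDeg, hset, ← Set.image_univ, Set.ncard_image_of_injective _ hinj, Set.ncard_univ,
      Nat.card_eq_fintype_card, Fintype.card_fin]
  refine ⟨D, fun v hv => ?_, fun v hv => ?_⟩
  · rw [hout]
    exact if_neg fun h => Set.disjoint_left.1 hdisj hv h
  · rw [hout]
    exact if_pos hv

/-! ### Layer decomposition of a potential -/

/-- `g` is integrable on `[-M, M]` with integral `v`. -/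
def HasIntegral (M : ℝ) (g : ℝ → ℝ) (v : ℝ) : Prop :=
  IntervalIntegrable g MeasureTheory.volume (-M) M ∧ ∫ t in (-M)..M, g t = v

lemma HasIntegral.add {M : ℝ} {g h : ℝ → ℝ} {a b : ℝ} (hg : HasIntegral M g a)
    (hh : HasIntegral M h b) : HasIntegral M (fun t => g t + h t) (a + b) :=
  ⟨hg.1.add hh.1, by rw [intervalIntegral.integral_add hg.1 hh.1, hg.2, hh.2]⟩

lemma HasIntegral.const_mul {M : ℝ} {g : ℝ → ℝ} {a : ℝ} (c : ℝ) (hg : HasIntegral M g a) :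
    HasIntegral M (fun t => c * g t) (c * a) :=
  ⟨hg.1.const_mul c, by rw [intervalIntegral.integral_const_mul, hg.2]⟩

lemma HasIntegral.zero (M : ℝ) : HasIntegral M (fun _ => 0) 0 :=
  ⟨intervalIntegrable_const, by simp⟩

lemma HasIntegral.sum {ι : Type*} {M : ℝ} {s : Finset ι} {g : ι → ℝ → ℝ} {a : ι → ℝ}
    (h : ∀ i ∈ s, HasIntegral M (g i) (a i)) :
    HasIntegral M (fun t => ∑ i ∈ s, g i t) (∑ i ∈ s, a i) := by
  induction s using Finset.induction_on with
  | empty => simpa using HasIntegral.zero M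
  | insert i s hi ih =>
    simp only [sum_insert hi]
    exact (h i (mem_insert_self i s)).add (ih fun j hj => h j (mem_insert_of_mem hj))

lemma HasIntegral.nonneg {M : ℝ} (hM : 0 ≤ M) {g : ℝ → ℝ} {a : ℝ} (h : HasIntegral M g a)
    (hg : ∀ t, 0 ≤ g t) : 0 ≤ a :=
  h.2 ▸ intervalIntegral.integral_nonneg (by linarith) fun t _ => hg t

lemma hasIntegral_lt {M a : ℝ} (ha : |a| ≤ M) :
    HasIntegral M (fun t => if t < a then 1 else 0) (a + M) := by
  obtain ⟨h1, h2⟩ := abs_le.1 ha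
  have hind : (fun t : ℝ => if t < a then (1 : ℝ) else 0) = (Set.Iio a).indicator fun _ => 1 := by
    ext t
    simp [Set.indicator]
  have hint : ∀ b c, IntervalIntegrable (fun t : ℝ => if t < a then (1 : ℝ) else 0)
      MeasureTheory.volume b c := fun b c => by
    rw [hind, intervalIntegrable_iff]
    exact (intervalIntegrable_iff.1 intervalIntegrable_const).indicator measurableSet_Iio
  refine ⟨hint _ _, ?_⟩
  rw [← intervalIntegral.integral_add_adjacent_intervals (hint (-M) a) (hint a M)]
  have hleft : ∫ t in (-M)..a, (if t < a then (1 : ℝ) else 0) = ∫ _ in (-M)..a, (1 : ℝ) := by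
    refine intervalIntegral.integral_congr_ae ?_
    filter_upwards [MeasureTheory.Measure.ae_ne MeasureTheory.volume a] with t ht hmem
    rw [Set.uIoc_of_le h1] at hmem
    exact if_pos (lt_of_le_of_ne hmem.2 ht)
  have hright : ∫ t in a..M, (if t < a then (1 : ℝ) else 0) = ∫ _ in a..M, (0 : ℝ) := by
    refine intervalIntegral.integral_congr fun t ht => ?_
    rw [Set.uIcc_of_le h2] at ht
    exact if_neg (not_lt.2 ht.1)
  rw [hleft, hright]
  simp

/-- If every cut of `D` satisfies the two capacity inequalities, then every potential `w` does. -/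
lemma potential_nonneg [Fintype V] {G : SimpleGraph V} (D : Orientation G) {r α : ℝ}
    (hcut : ∀ A : Set V, outCut D A - (r - 1) * outCut D Aᶜ ≤ α * A.ncard ∧
      outCut D Aᶜ - (r - 1) * outCut D A ≤ α * A.ncard) (w : V → ℝ) :
    0 ≤ (∑ x, ∑ y, (if D.dir x y then 1 else 0) *
        ((r - 1) * w x + (-1) * w y + (2 - r) * min (w x) (w y))) + ∑ x, α * |w x| := by
  obtain ⟨M, hM0, hM⟩ : ∃ M : ℝ, 0 ≤ M ∧ ∀ x, |w x| ≤ M :=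
    ⟨∑ x, |w x|, sum_nonneg fun _ _ => abs_nonneg _,
      fun x => single_le_sum (f := fun x => |w x|) (fun _ _ => abs_nonneg _) (mem_univ x)⟩
  have hmin : ∀ a b : ℝ, |a| ≤ M → |b| ≤ M → |min a b| ≤ M := fun a b ha hb => by
    rcases min_choice a b with h | h <;> rwa [h]
  have hI := (HasIntegral.sum fun x (_ : x ∈ univ) => HasIntegral.sum fun y (_ : y ∈ univ) =>
    ((((hasIntegral_lt (hM x)).const_mul (r - 1)).add ((hasIntegral_lt (hM y)).const_mul (-1))).add
      ((hasIntegral_lt (hmin _ _ (hM x) (hM y))).const_mul (2 - r))).const_mul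
        (if D.dir x y then 1 else 0)).add
    (HasIntegral.sum fun x (_ : x ∈ univ) =>
      (((hasIntegral_lt (hM x)).add
        ((hasIntegral_lt (hmin _ 0 (hM x) (by simpa using hM0))).const_mul (-2))).add
        (hasIntegral_lt (a := 0) (by simpa using hM0))).const_mul α)
  refine (hI.nonneg hM0 fun t => ?_).trans_eq ?_
  · have hedge : (∑ x, ∑ y, (if D.dir x y then 1 else 0) *
        ((r - 1) * (if t < w x then 1 else 0) + -1 * (if t < w y then 1 else 0) +
          (2 - r) * if t < min (w x) (w y) then 1 else 0)) =
        (r - 1) * outCut D {x | t < w x} - outCut D {x | t < w x}ᶜ := by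
      unfold outCut outFlow
      simp only [mul_sum, ← sum_sub_distrib]
      refine sum_congr rfl fun x _ => sum_congr rfl fun y _ => ?_
      by_cases hd : D.dir x y <;> by_cases hx : t < w x <;> by_cases hy : t < w y <;>
        simp [hd, hx, hy]
      ring
    have hvert : ∀ A : Set V, α * A.ncard = ∑ x, α * if x ∈ A then 1 else 0 := fun A => by
      have := ncard_inter_eq_sum Set.univ A
      rw [Set.univ_inter] at this
      rw [this, mul_sum]
      simp
    rw [hedge]
    rcases le_or_gt 0 t with ht | ht
    · have h := (hcut {x | t < w x}).2
      rw [hvert] at h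
      have heq : ∀ x, α * ((if t < w x then (1 : ℝ) else 0) +
          -2 * (if t < min (w x) 0 then 1 else 0) + if t < 0 then 1 else 0) =
          α * if x ∈ {x | t < w x} then 1 else 0 := fun x => by
        simp [not_lt.2 ht]
      simp only [heq]
      linarith
    · have h := (hcut {x | t < w x}ᶜ).1
      rw [compl_compl] at h
      have heq : ∑ x, α * ((if t < w x then (1 : ℝ) else 0) +
          -2 * (if t < min (w x) 0 then 1 else 0) + if t < 0 then 1 else 0) =
          α * ({x | t < w x}ᶜ : Set V).ncard := by
        rw [hvert]
        refine sum_congr rfl fun x _ => ?_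
        by_cases hx : t < w x <;> simp [ht, hx]
        norm_num
      rw [heq]
      linarith
  · congr 1
    · refine sum_congr rfl fun x _ => sum_congr rfl fun y _ => ?_
      ring
    · refine sum_congr rfl fun x _ => ?_
      rcases le_total (w x) 0 with h | h
      · rw [min_eq_left h, abs_of_nonpos h]; ring
      · rw [min_eq_right h, abs_of_nonneg h]; ring

/-! ### From cut conditions to flows -/

/-- A Hoffman-type circulation theorem: the cut inequalities suffice for a bounded excess flow
in a fixed orientation. -/
lemma exists_isBEFlow [Fintype V] {G : SimpleGraph V} (D : Orientation G) {r α : ℝ} (hr : 2 ≤ r)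
    (hα0 : 0 ≤ α)
    (hcut : ∀ A : Set V, outCut D A - (r - 1) * outCut D Aᶜ ≤ α * A.ncard ∧
      outCut D Aᶜ - (r - 1) * outCut D A ≤ α * A.ncard) :
    ∃ f, IsBEFlow D r α f := by
  let L : (Sym2 V → ℝ) →ₗ[ℝ] (V → ℝ) :=
    { toFun := fun f => excess D f
      map_add' := fun f g => by
        ext x
        simp only [excess, Pi.add_apply]
        have h : ∀ p : V → Prop, ∑ y, (if p y then f s(x, y) + g s(x, y) else 0) =
            ∑ y, (if p y then f s(x, y) else 0) + ∑ y, (if p y then g s(x, y) else 0) :=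
          fun p => by
            rw [← sum_add_distrib]
            refine sum_congr rfl fun y _ => ?_
            split_ifs <;> simp
        rw [h, h]
        ring
      map_smul' := fun c f => by
        ext x
        simp only [excess, Pi.smul_apply, smul_eq_mul, RingHom.id_apply, mul_sub, mul_sum,
          mul_ite, mul_zero] }
  by_contra hno
  have hdisj : Disjoint (L '' Set.Icc (fun _ => 1) (fun _ => r - 1))
      (Set.Icc (fun _ => -α) (fun _ => α)) := by
    rw [Set.disjoint_left]
    rintro _ ⟨f, ⟨hf1, hf2⟩, rfl⟩ ⟨hz1, hz2⟩
    exact hno ⟨f, fun e _ => ⟨hf1 e, hf2 e⟩, fun x => abs_le.2 ⟨hz1 x, hz2 x⟩⟩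
  obtain ⟨φ, u, v, hu, huv, hv⟩ := geometric_hahn_banach_compact_closed
    ((convex_Icc _ _).linear_image L)
    (isCompact_Icc.image L.continuous_of_finiteDimensional) (convex_Icc _ _) isClosed_Icc hdisj
  let w : V → ℝ := fun x => φ (Pi.single x 1)
  have hφ : ∀ z : V → ℝ, φ z = ∑ x, w x * z x := fun z => by
    have := LinearMap.pi_apply_eq_sum_univ φ.toLinearMap z
    simp only [ContinuousLinearMap.coe_coe, smul_eq_mul] at this
    rw [this]
    refine sum_congr rfl fun x _ => ?_
    rw [mul_comm]
    congr 2
    ext j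
    simp [Pi.single_apply, eq_comm]
  let f : Sym2 V → ℝ := fun e => if ∃ x y, e = s(x, y) ∧ D.dir x y ∧ w y ≤ w x then r - 1 else 1
  have hf : ∀ x y, D.dir x y → f s(x, y) = if w y ≤ w x then r - 1 else 1 := by
    intro x y hd
    have : (∃ a b, s(x, y) = s(a, b) ∧ D.dir a b ∧ w b ≤ w a) ↔ w y ≤ w x := by
      constructor
      · rintro ⟨a, b, hab, hd', hw⟩
        rcases Sym2.eq_iff.1 hab with ⟨rfl, rfl⟩ | ⟨rfl, rfl⟩
        · exact hw
        · exact absurd hd' (D.not_dir_symm hd)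
      · exact fun hw => ⟨x, y, rfl, hd, hw⟩
    simp only [f, this]
  have hfmem : f ∈ Set.Icc (fun _ : Sym2 V => (1 : ℝ)) (fun _ => r - 1) := by
    constructor <;> intro e <;> simp only [f] <;> split_ifs <;> linarith
  have h1 := hu (L f) ⟨f, hfmem, rfl⟩
  have h2 := hv (fun x => if 0 ≤ w x then -α else α) (by
    constructor <;> intro x <;> dsimp only <;> split_ifs <;> linarith)
  rw [hφ] at h1 h2
  have h3 := potential_nonneg D hcut w
  have h4 : ∑ x, w x * (L f) x = ∑ x, ∑ y, (if D.dir x y then 1 else 0) *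
        ((r - 1) * w x + (-1) * w y + (2 - r) * min (w x) (w y)) := by
    refine (sum_mul_excess D f w).trans ?_
    refine sum_congr rfl fun x _ => sum_congr rfl fun y _ => ?_
    by_cases hd : D.dir x y
    · rw [if_pos hd, if_pos hd, hf x y hd]
      split_ifs with hw
      · rw [min_eq_right hw]; ring
      · rw [min_eq_left (not_le.1 hw).le]; ring
    · simp [hd]
  have h5 : ∑ x, w x * (if 0 ≤ w x then -α else α) = -∑ x, α * |w x| := by
    rw [← sum_neg_distrib]
    refine sum_congr rfl fun x _ => ?_
    split_ifs with hw
    · rw [abs_of_nonneg hw]; ring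
    · rw [abs_of_neg (not_le.1 hw)]; ring
  linarith

lemma hasFlow_of_bisection [Fintype V] {G : SimpleGraph V} (hG : IsCubic G) {r α : ℝ}
    (hr : 2 ≤ r) (hα0 : 0 ≤ α) {V₁ V₂ : Set V} (hb : IsBisection V₁ V₂)
    (hd : ∀ A : Set V, disc V₁ V₂ A ≤ (cutCard G A : ℤ))
    (hc : ∀ A : Set V, A.Nonempty →
      (2 * (cutCard G A : ℝ) - ((cutCard G A : ℝ) - (disc V₁ V₂ A : ℝ)) * r)
        / (2 * (A.ncard : ℝ)) ≤ α) :
    HasFlow G r α := by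
  obtain ⟨D, h₁, h₂⟩ := orientable_of_disc_le hG hb hd
  refine ⟨D, exists_isBEFlow D hr hα0 fun A => ?_⟩
  rcases A.eq_empty_or_nonempty with rfl | hA
  · simp [outCut, outFlow]
  have hpos : (0 : ℝ) < A.ncard := by exact_mod_cast (Set.ncard_pos).2 hA
  have h := hc A hA
  rw [div_le_iff₀ (by positivity), disc_cast,
    ncard_sub_ncard_eq_outCut_sub hG D hb.1 hb.2.1 h₁ h₂, cutCard_eq_outCut_add D] at h
  have hle := mul_le_mul_of_nonneg_right (le_abs_self (outCut D A - outCut D Aᶜ))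
    (by linarith : 0 ≤ r)
  have hge := mul_le_mul_of_nonneg_right (neg_le_abs (outCut D A - outCut D Aᶜ))
    (by linarith : 0 ≤ r)
  constructor <;> linarith

/-- existence of an `(r, α)`-flow is equivalent to the existence of a
bisection satisfying the two cut conditions. -/
theorem stmt1 [Fintype V] (G : SimpleGraph V) (hG : IsCubic G)
    (r α : ℝ) (hr : 2 ≤ r) (hα0 : 0 ≤ α) (hα3 : α < 3) :
    HasFlow G r α ↔ ∃ V₁ V₂ : Set V, IsBisection V₁ V₂ ∧
      (∀ A : Set V, disc V₁ V₂ A ≤ (cutCard G A : ℤ)) ∧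
      (∀ A : Set V, A.Nonempty →
        (2 * (cutCard G A : ℝ) - ((cutCard G A : ℝ) - (disc V₁ V₂ A : ℝ)) * r)
          / (2 * (A.ncard : ℝ)) ≤ α) := by
  exact ⟨exists_bisection_of_hasFlow hG hα3,
    fun ⟨_, _, hb, hd, hc⟩ => hasFlow_of_bisection hG hr hα0 hb hd hc⟩

end BEF
end

section
/- Let a cubic graph G admit an (r₀,α₀)-flow, where r₀≥2 and 0≤α₀<1. If the reals s,β satisfy s≥2, β≥α₀, and either β≥1 or (s−2)(1−α₀) ≥ (r₀−2)(1−β), then G admits an (s,β)-flow. (In other words, every point of the upper-right domain urd(r₀,α₀), the closed unbounded polygonal region with vertices (2,∞), (2,1), (r₀,α₀), (∞,α₀), lies in bed(G).) -/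
open Finset
open scoped Classical

namespace BEF

variable {V : Type*}

theorem HasFlow.mono [Fintype V] {G : SimpleGraph V} {r s α β : ℝ} (h : HasFlow G r α)
    (hrs : r ≤ s) (hαβ : α ≤ β) : HasFlow G s β := by
  obtain ⟨D, f, hf, hx⟩ := h
  exact ⟨D, f, fun e he => ⟨(hf e he).1, (hf e he).2.trans (by linarith)⟩,
    fun x => (hx x).trans hαβ⟩

theorem excess_eq_sum_filter [Fintype V] {G : SimpleGraph V} (D : Orientation G)
    (f : Sym2 V → ℝ) (x : V) :
    excess D f x = ∑ y with D.dir x y, f s(x, y) - ∑ y with D.dir y x, f s(x, y) := by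
  simp only [excess, Finset.sum_filter]

/-- Excess is affine in the flow values. -/
theorem excess_one_add_mul [Fintype V] {G : SimpleGraph V} (D : Orientation G)
    (f : Sym2 V → ℝ) (t : ℝ) (x : V) :
    excess D (fun e => 1 + t * (f e - 1)) x
      = (1 - t) * excess D (fun _ => 1) x + t * excess D f x := by
  have h : ∀ a : ℝ, 1 + t * (a - 1) = (1 - t) * 1 + t * a := fun a => by ring
  simp only [excess_eq_sum_filter, h, Finset.sum_add_distrib, ← Finset.mul_sum]
  ring

/-- In a cubic graph the in- and outdegree of a vertex sum to three. -/
theorem card_out_add_card_in [Fintype V] {G : SimpleGraph V} (hG : IsCubic G)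
    (D : Orientation G) (x : V) :
    #{y | D.dir x y} + #{y | D.dir y x} = 3 := by
  rw [← Finset.card_union_of_disjoint, ← hG x, ← Set.ncard_coe_finset]
  · congr 1
    ext y
    simp only [coe_union, coe_filter, mem_univ, true_and, Set.mem_union, Set.mem_ofPred_eq,
      SimpleGraph.mem_neighborSet]
    refine ⟨fun h => h.elim (D.adj_of_dir x y) fun h => (D.adj_of_dir y x h).symm, fun h => ?_⟩
    have := D.dir_iff_not x y h
    tauto
  · refine Finset.disjoint_filter.2 fun y _ h => ?_
    exact (D.dir_iff_not x y (D.adj_of_dir x y h)).1 h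

/-- A flow with excess below one forces its orientation to be balanced, so that the constant
flow has excess at most one. -/
theorem IsBEFlow.abs_excess_one_le [Fintype V] {G : SimpleGraph V} (hG : IsCubic G)
    {D : Orientation G} {r α : ℝ} {f : Sym2 V → ℝ} (h : IsBEFlow D r α f) (hα : α < 1)
    (x : V) : |excess D (fun _ => 1) x| ≤ 1 := by
  obtain ⟨hf, hx⟩ := h
  have hcard := card_out_add_card_in hG D x
  have hout : (#{y | D.dir x y} : ℝ) ≤ ∑ y with D.dir x y, f s(x, y) := by
    simpa using Finset.card_nsmul_le_sum {y | D.dir x y} (fun y => f s(x, y)) 1 fun y hy =>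
      (hf _ (D.adj_of_dir x y (by simpa using hy))).1
  have hin : (#{y | D.dir y x} : ℝ) ≤ ∑ y with D.dir y x, f s(x, y) := by
    simpa using Finset.card_nsmul_le_sum {y | D.dir y x} (fun y => f s(x, y)) 1 fun y hy =>
      (hf _ (D.adj_of_dir y x (by simpa using hy)).symm).1
  have hexc := abs_le.1 (hx x)
  rw [excess_eq_sum_filter] at hexc
  have hout0 : #{y | D.dir x y} ≠ 0 := fun h0 => by
    have h3 : #{y | D.dir y x} = 3 := by omega
    rw [h3] at hin
    rw [Finset.card_eq_zero.1 h0, Finset.sum_empty] at hexc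
    norm_num at hin
    linarith [hexc.1]
  have hin0 : #{y | D.dir y x} ≠ 0 := fun h0 => by
    have h3 : #{y | D.dir x y} = 3 := by omega
    rw [h3] at hout
    rw [Finset.card_eq_zero.1 h0, Finset.sum_empty] at hexc
    norm_num at hout
    linarith [hexc.2]
  rw [excess_eq_sum_filter, Finset.sum_const, Finset.sum_const, nsmul_one, nsmul_one, abs_le]
  have h₁ : (#{y | D.dir x y} : ℝ) ≤ #{y | D.dir y x} + 1 := by norm_cast; omega
  have h₂ : (#{y | D.dir y x} : ℝ) ≤ #{y | D.dir x y} + 1 := by norm_cast; omega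
  constructor <;> linarith

/-- Contracting a flow towards the constant flow moves `(r, α)` along the segment
to `(2, 1)`. -/
theorem HasFlow.segment [Fintype V] {G : SimpleGraph V} (hG : IsCubic G) {r α t : ℝ}
    (hα : α < 1) (ht0 : 0 ≤ t) (ht1 : t ≤ 1) (h : HasFlow G r α) :
    HasFlow G (2 + t * (r - 2)) (1 - t * (1 - α)) := by
  obtain ⟨D, f, h⟩ := h
  refine ⟨D, fun e => 1 + t * (f e - 1), fun e he => ?_, fun x => ?_⟩
  · obtain ⟨h₁, h₂⟩ := h.1 e he
    constructor <;> nlinarith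
  · rw [excess_one_add_mul]
    have h₁ := abs_le.1 (h.abs_excess_one_le hG hα x)
    have h₂ := abs_le.1 (h.2 x)
    rw [abs_le]
    constructor <;> nlinarith

/-- `urd(r₀, α₀) ⊆ bed(G)` whenever `(r₀, α₀) ∈ bed(G)`. -/
theorem stmt5 [Fintype V] (G : SimpleGraph V) (hG : IsCubic G)
    (r₀ α₀ s β : ℝ) (hr₀ : 2 ≤ r₀) (hα₀0 : 0 ≤ α₀) (hα₀1 : α₀ < 1)
    (hs : 2 ≤ s) (hβ : α₀ ≤ β)
    (hurd : 1 ≤ β ∨ (r₀ - 2) * (1 - β) ≤ (s - 2) * (1 - α₀))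
    (h : HasFlow G r₀ α₀) : HasFlow G s β := by
  have hα : 0 < 1 - α₀ := by linarith
  by_cases hβ1 : 1 ≤ β
  · exact (h.segment hG hα₀1 le_rfl zero_le_one).mono (by linarith) (by linarith)
  · have hle := hurd.resolve_left hβ1
    refine (h.segment hG hα₀1 (t := (1 - β) / (1 - α₀)) (div_nonneg (by linarith) hα.le)
      ((div_le_one hα).2 (by linarith))).mono ?_ ?_
    · have : (1 - β) / (1 - α₀) * (r₀ - 2) ≤ s - 2 := by
        rw [div_mul_eq_mul_div, div_le_iff₀ hα]
        linarith
      linarith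
    · rw [div_mul_cancel₀ _ hα.ne']
      linarith

end BEF
end

section
/- Let G be a cubic graph and k≥3 an integer. The following three statements are equivalent: (1) G admits an orientable k-weak bisection; (2) G admits a (3+(k−3)/(k−1), (k−3)/(k−1))-flow; (3) G admits an (r,α)-flow for some reals r≥2 and 0≤α<1 with tr(r,α) < k+1. -/
open Finset
open scoped Classical

namespace BEF

variable {V : Type*}

namespace Orientation

variable {G : SimpleGraph V}

theorem not_dir_symm_s6 (D : Orientation G) {u v : V} (h : D.dir u v) : ¬ D.dir v u :=
  (D.dir_iff_not u v (D.adj_of_dir u v h)).1 h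

theorem dir_or_dir (D : Orientation G) {u v : V} (h : G.Adj u v) : D.dir u v ∨ D.dir v u := by
  have := D.dir_iff_not u v h
  tauto

/-- The orientation with all edges reversed. -/
def reverse (D : Orientation G) : Orientation G where
  dir u v := D.dir v u
  adj_of_dir u v h := (D.adj_of_dir v u h).symm
  dir_iff_not u v h := D.dir_iff_not v u h.symm

/-- The arcs of `D` between vertices of `S`. -/
def arcOn (D : Orientation G) (S : Set V) (u v : S) : Prop := D.dir u v

/-- A vertex of outdegree one has a unique out-neighbour. -/
theorem eq_of_dir_of_outDeg_eq_one (D : Orientation G) {u v w : V} (h : outDeg D u = 1)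
    (hv : D.dir u v) (hw : D.dir u w) : v = w := by
  obtain ⟨y, hy⟩ := Set.ncard_eq_one.1 h
  have hv' : v ∈ {y | D.dir u y} := hv
  have hw' : w ∈ {y | D.dir u y} := hw
  rw [hy] at hv' hw'
  exact hv'.trans hw'.symm

theorem rightUnique_arcOn (D : Orientation G) {S : Set V} (hS : ∀ v ∈ S, outDeg D v = 1) :
    Relator.RightUnique (D.arcOn S) := fun u _ _ hv hw =>
  Subtype.ext (D.eq_of_dir_of_outDeg_eq_one (hS u u.2) hv hw)

theorem reachable_of_arcOn (D : Orientation G) {S : Set V} {u v : S}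
    (h : Relation.ReflTransGen (D.arcOn S) u v) : (G.induce S).Reachable u v := by
  induction h with
  | refl => rfl
  | tail _ hbc ih =>
    exact ih.trans (SimpleGraph.Adj.reachable (D.adj_of_dir _ _ hbc))

/-- An acyclic induced subgraph contains no directed cycle. -/
theorem not_arcOn_of_reflTransGen (D : Orientation G) {S : Set V}
    (hac : (G.induce S).IsAcyclic) {u v : S} (h : Relation.ReflTransGen (D.arcOn S) v u) :
    ¬ D.arcOn S u v := by
  intro huv
  have hbr := SimpleGraph.isAcyclic_iff_forall_adj_isBridge.1 hac
    (show (G.induce S).Adj u v from D.adj_of_dir _ _ huv)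
  refine SimpleGraph.isBridge_iff.1 hbr (SimpleGraph.Reachable.symm ?_)
  clear hbr
  have key : ∀ w, Relation.ReflTransGen (D.arcOn S) w u →
      ((G.induce S).deleteEdges {s(u, v)}).Reachable w u := by
    intro w hw
    induction hw using Relation.ReflTransGen.head_induction_on with
    | refl => rfl
    | @head a c hac _ ih =>
      by_cases hau : a = u
      · rw [hau]
      refine SimpleGraph.Reachable.trans (SimpleGraph.Adj.reachable ?_) ih
      rw [SimpleGraph.deleteEdges_adj]
      refine ⟨D.adj_of_dir _ _ hac, fun he => ?_⟩
      rcases Sym2.eq_iff.1 (Set.mem_singleton_iff.1 he) with ⟨h1, -⟩ | ⟨rfl, rfl⟩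
      · exact hau h1
      · exact D.not_dir_symm_s6 huv hac
  exact key v h

/-- In a set of vertices of outdegree one, being able to reach `x` along arcs passes to
neighbours, except along an arc leaving `x`. -/
theorem reflTransGen_of_adj (D : Orientation G) {S : Set V} (hS : ∀ v ∈ S, outDeg D v = 1)
    {x z w : S} (hz : Relation.ReflTransGen (D.arcOn S) z x) (hzw : (G.induce S).Adj z w)
    (hx : z = x → ¬ D.arcOn S z w) : Relation.ReflTransGen (D.arcOn S) w x := by
  rcases D.dir_or_dir (show G.Adj z w from hzw) with h | h
  · rcases hz.cases_head with rfl | ⟨c, hc, hcx⟩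
    · exact absurd h (hx rfl)
    · rwa [D.rightUnique_arcOn hS (show D.arcOn S z w from h) hc]
  · exact hz.head h

/-- The flow value of the arc from `u` to `v` determined by vertex weights `a` and `b`. -/
noncomputable def arcFlow (D : Orientation G) (β : ℝ) (a b : V → ℕ) (u v : V) : ℝ :=
  if D.dir u v then 1 + β * max (a u) (b v) else 0

/-- The edge function determined by vertex weights `a` (for tails) and `b` (for heads). -/
noncomputable def edgeFlow (D : Orientation G) (β : ℝ) (a b : V → ℕ) : Sym2 V → ℝ :=
  Sym2.lift ⟨fun u v => D.arcFlow β a b u v + D.arcFlow β a b v u, fun _ _ => add_comm _ _⟩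

theorem edgeFlow_of_dir (D : Orientation G) (β : ℝ) (a b : V → ℕ) {u v : V} (h : D.dir u v) :
    D.edgeFlow β a b s(u, v) = 1 + β * max (a u) (b v) := by
  simp [edgeFlow, arcFlow, h, D.not_dir_symm_s6 h]

variable [Fintype V]

/-- The vertices of `S` from which `x` can be reached along arcs inside `S`;
empty if `x` is not in `S`. -/
noncomputable def ancestors (D : Orientation G) (S : Set V) (x : V) : Finset S :=
  {w : S | ∃ h : x ∈ S, Relation.ReflTransGen (D.arcOn S) w ⟨x, h⟩}

theorem mem_ancestors (D : Orientation G) {S : Set V} {x : V} {w : S} :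
    w ∈ D.ancestors S x ↔ ∃ h : x ∈ S, Relation.ReflTransGen (D.arcOn S) w ⟨x, h⟩ := by
  simp [ancestors]

theorem ancestors_eq_empty (D : Orientation G) {S : Set V} {x : V} (hx : x ∉ S) :
    D.ancestors S x = ∅ := by
  ext w
  simp [mem_ancestors, hx]

theorem card_ancestors_le (D : Orientation G) {S : Set V} {k : ℕ} (hS : WeakSide G k S) (x : V) :
    #(D.ancestors S x) ≤ k - 2 := by
  by_cases hx : x ∈ S
  · refine le_trans ?_ (hS.2 ((G.induce S).connectedComponentMk ⟨x, hx⟩))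
    rw [← Set.ncard_coe_finset]
    refine Set.ncard_le_ncard (fun w hw => ?_) (Set.toFinite _)
    obtain ⟨_, h⟩ := D.mem_ancestors.1 (Finset.mem_coe.1 hw)
    exact SimpleGraph.ConnectedComponent.sound (D.reachable_of_arcOn h)
  · simp [D.ancestors_eq_empty hx]

theorem card_ancestors (D : Orientation G) {S : Set V} (hS : ∀ v ∈ S, outDeg D v = 1)
    (hac : (G.induce S).IsAcyclic) {x : V} (hx : x ∈ S) :
    #(D.ancestors S x) = 1 + ∑ y with D.dir y x, #(D.ancestors S y) := by
  have hdisj : ∀ y z : V, D.dir y x → D.dir z x → ∀ (hy : y ∈ S) (hz : z ∈ S),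
      Relation.ReflTransGen (D.arcOn S) ⟨y, hy⟩ ⟨z, hz⟩ → y = z := by
    intro y z hyx hzx hy hz h
    rcases h.cases_head with h | ⟨c, hc, hcz⟩
    · exact congrArg Subtype.val h
    · have hcx : c = ⟨x, hx⟩ := D.rightUnique_arcOn hS hc (show D.arcOn S ⟨y, hy⟩ ⟨x, hx⟩ from hyx)
      subst hcx
      exact absurd hzx (D.not_arcOn_of_reflTransGen hac hcz)
  rw [← Finset.card_biUnion]
  · have hnot : (⟨x, hx⟩ : S) ∉ ({y | D.dir y x} : Finset V).biUnion (D.ancestors S) := by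
      simp only [Finset.mem_biUnion, Finset.mem_filter, Finset.mem_univ, true_and, mem_ancestors,
        not_exists, not_and]
      intro y hyx hy h
      exact D.not_arcOn_of_reflTransGen hac h hyx
    rw [add_comm, ← Finset.card_insert_of_notMem hnot]
    congr 1
    ext w
    simp only [Finset.mem_insert, Finset.mem_biUnion, Finset.mem_filter, Finset.mem_univ,
      true_and, mem_ancestors]
    constructor
    · rintro ⟨_, h⟩
      rcases Relation.ReflTransGen.cases_tail h with h | ⟨c, hwc, hc⟩
      · exact Or.inl h.symm
      · exact Or.inr ⟨c, hc, c.2, hwc⟩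
    · rintro (rfl | ⟨y, hyx, hy, h⟩)
      · exact ⟨hx, .refl⟩
      · exact ⟨hx, h.tail hyx⟩
  · intro y hy z hz hyz
    simp only [Finset.coe_filter, Finset.mem_univ, true_and, Set.mem_ofPred_eq] at hy hz
    refine Finset.disjoint_left.2 fun w hwy hwz => hyz ?_
    obtain ⟨hyS, h1⟩ := D.mem_ancestors.1 hwy
    obtain ⟨hzS, h2⟩ := D.mem_ancestors.1 hwz
    rcases Relation.ReflTransGen.total_of_right_unique (D.rightUnique_arcOn hS) h1 h2 with h | h
    · exact hdisj y z hy hz hyS hzS h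
    · exact (hdisj z y hz hy hzS hyS h).symm

theorem outDeg_eq_card (D : Orientation G) (x : V) : outDeg D x = #{y | D.dir x y} := by
  rw [outDeg, ← Set.ncard_coe_finset]
  simp

/-- In a cubic graph, outdegree and indegree add up to three. -/
theorem outDeg_add_outDeg_reverse (D : Orientation G) (hG : IsCubic G) (x : V) :
    outDeg D x + outDeg D.reverse x = 3 := by
  rw [← hG x, outDeg, outDeg, ← Set.ncard_union_eq _ (Set.toFinite _) (Set.toFinite _)]
  · congr 1
    ext y
    constructor
    · rintro (h | h)
      · exact D.adj_of_dir _ _ h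
      · exact (D.adj_of_dir _ _ h).symm
    · exact fun h => D.dir_or_dir h
  · exact Set.disjoint_left.2 fun y h h' => D.not_dir_symm_s6 h h'

theorem excess_reverse (D : Orientation G) (f : Sym2 V → ℝ) (x : V) :
    excess D.reverse f x = - excess D f x := by
  rw [excess, excess, neg_sub]
  rfl

theorem isBEFlow_reverse (D : Orientation G) {r α : ℝ} {f : Sym2 V → ℝ} (h : IsBEFlow D r α f) :
    IsBEFlow D.reverse r α f :=
  ⟨h.1, fun x => by rw [D.excess_reverse, abs_neg]; exact h.2 x⟩

theorem excess_one (D : Orientation G) (x : V) :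
    excess D (fun _ => 1) x = outDeg D x - outDeg D.reverse x := by
  simp [excess, outDeg_eq_card, reverse]

theorem excess_sub (D : Orientation G) (f g : Sym2 V → ℝ) (x : V) :
    excess D (f - g) x = excess D f x - excess D g x := by
  have h : ∀ (p : Prop) [Decidable p] (a b : ℝ),
      (if p then a - b else 0) = (if p then a else 0) - (if p then b else 0) := by
    intros; split_ifs <;> simp
  simp only [excess, Pi.sub_apply, h, Finset.sum_sub_distrib]
  ring

/-- The total excess of a vertex set is the net flow leaving it. -/
theorem sum_excess (D : Orientation G) (f : Sym2 V → ℝ) (A : Finset V) :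
    ∑ x ∈ A, excess D f x =
      ∑ x ∈ A, ∑ y ∈ Aᶜ, (if D.dir x y then f s(x, y) else 0) -
        ∑ x ∈ A, ∑ y ∈ Aᶜ, (if D.dir y x then f s(x, y) else 0) := by
  have hin : ∑ x ∈ A, ∑ y ∈ A, (if D.dir y x then f s(x, y) else 0) =
      ∑ x ∈ A, ∑ y ∈ A, (if D.dir x y then f s(x, y) else 0) := by
    rw [Finset.sum_comm]
    simp only [Sym2.eq_swap]
  simp only [excess, ← Finset.sum_add_sum_compl A, Finset.sum_sub_distrib, Finset.sum_add_distrib,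
    hin]
  ring

/-- A set `A` of vertices of outdegree one is small if few of its vertices have an arc
leaving `A`. -/
theorem mul_card_le_of_isBEFlow (D : Orientation G) (hG : IsCubic G) {r α : ℝ} {f : Sym2 V → ℝ}
    (hf : IsBEFlow D r α f) (hr : 2 ≤ r) {A : Finset V} (hA : ∀ x ∈ A, outDeg D x = 1) :
    (1 - α) * #A ≤ (r - 2) * #{x ∈ A | ∃ y, D.dir x y ∧ y ∉ A} := by
  have hex : ∀ x ∈ A, 1 - α ≤ excess D (f - fun _ => 1) x := by
    intro x hx
    have h1 := hA x hx
    have h2 := D.outDeg_add_outDeg_reverse hG x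
    have h3 : outDeg D.reverse x = 2 := by omega
    rw [D.excess_sub, D.excess_one, h1, h3]
    have := (abs_le.1 (hf.2 x)).1
    push_cast
    linarith
  have hb : ∀ x y, D.dir x y → 1 ≤ f s(x, y) ∧ f s(x, y) ≤ r - 1 := fun x y h =>
    hf.1 _ (D.adj_of_dir _ _ h)
  have hin : 0 ≤ ∑ x ∈ A, ∑ y ∈ Aᶜ, (if D.dir y x then (f - fun _ => 1 : Sym2 V → ℝ) s(x, y) else 0) := by
    refine Finset.sum_nonneg fun x _ => Finset.sum_nonneg fun y _ => ?_
    split_ifs with h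
    · have := (hb _ _ h).1
      rw [Sym2.eq_swap] at this
      simp [this]
    · rfl
  have hout : ∀ x ∈ A, ∑ y ∈ Aᶜ, (if D.dir x y then (f - fun _ => 1 : Sym2 V → ℝ) s(x, y) else 0) ≤
      if ∃ y, D.dir x y ∧ y ∉ A then r - 2 else 0 := by
    intro x hx
    split_ifs with h
    · obtain ⟨y, hy, -⟩ := h
      calc _ ≤ ∑ z ∈ Aᶜ, if y = z then r - 2 else 0 := by
            refine Finset.sum_le_sum fun z _ => ?_
            split_ifs with h1 h2 h2
            · have := (hb _ _ h1).2
              simp only [Pi.sub_apply]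
              linarith
            · exact absurd (D.eq_of_dir_of_outDeg_eq_one (hA x hx) hy h1) h2
            · linarith
            · rfl
        _ ≤ r - 2 := by
            rw [Finset.sum_ite_eq]
            split_ifs
            · rfl
            · linarith
    · refine (Finset.sum_eq_zero fun y hy => if_neg fun hxy => h ⟨y, hxy, ?_⟩).le
      exact Finset.mem_compl.1 hy
  have h1 := Finset.sum_le_sum hex
  have h2 := Finset.sum_le_sum hout
  rw [D.sum_excess, Finset.sum_const, nsmul_eq_mul] at h1
  rw [← Finset.sum_filter, Finset.sum_const, nsmul_eq_mul] at h2
  linarith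

/-- The vertices of outdegree one induce small trees if `D` carries a flow of small trace. -/
theorem weakSide_of_isBEFlow (D : Orientation G) (hG : IsCubic G) {r α : ℝ} {f : Sym2 V → ℝ}
    (hf : IsBEFlow D r α f) (hr : 2 ≤ r) (hα : α < 1) {k : ℕ} (hk : 3 ≤ k)
    (htr : (r - 2 * α) / (1 - α) < (k : ℝ) + 1) {S : Set V} (hS : ∀ v ∈ S, outDeg D v = 1) :
    WeakSide G k S := by
  -- A nonempty subset of `S` has a vertex with an arc leaving it.
  have hexit : ∀ A : Finset S, A.Nonempty → ∃ x ∈ A, ∀ y ∈ A, ¬ D.arcOn S x y := by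
    intro A hne
    by_contra! hcon
    have h := D.mul_card_le_of_isBEFlow hG hf hr (A := A.map (.subtype _)) (by
      intro x hx
      obtain ⟨y, -, rfl⟩ := Finset.mem_map.1 hx
      exact hS _ y.2)
    rw [Finset.filter_eq_empty_iff.2, Finset.card_map, Finset.card_empty, Nat.cast_zero, mul_zero] at h
    · have : (0 : ℝ) < #A := by exact_mod_cast hne.card_pos
      nlinarith
    · rintro x hx ⟨y, hxy, hy⟩
      obtain ⟨x, hxA, rfl⟩ := Finset.mem_map.1 hx
      obtain ⟨z, hz, hxz⟩ := hcon x hxA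
      rw [D.eq_of_dir_of_outDeg_eq_one (hS _ x.2) hxy hxz] at hy
      exact hy (Finset.mem_map_of_mem _ hz)
  constructor
  · rw [SimpleGraph.isAcyclic_iff_forall_adj_isBridge]
    intro u v huv
    wlog hdir : D.arcOn S u v generalizing u v
    · rw [Sym2.eq_swap]
      exact this huv.symm ((D.dir_or_dir (show G.Adj u v from huv)).resolve_left hdir)
    rw [SimpleGraph.isBridge_iff]
    rintro ⟨p⟩
    have hclosed : ∀ a b, ((G.induce S).deleteEdges {s(u, v)}).Walk a b →
        Relation.ReflTransGen (D.arcOn S) a u → Relation.ReflTransGen (D.arcOn S) b u := by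
      intro a b p ha
      induction p with
      | nil => exact ha
      | cons h _ ih =>
        rw [SimpleGraph.deleteEdges_adj] at h
        refine ih (D.reflTransGen_of_adj hS ha h.1 ?_)
        rintro rfl harc
        rw [D.rightUnique_arcOn hS harc hdir] at h
        exact h.2 rfl
    have hvu := hclosed u v p .refl
    obtain ⟨x, hx, hx'⟩ := hexit {w : S | Relation.ReflTransGen (D.arcOn S) w u ∧
      Relation.ReflTransGen (D.arcOn S) u w} ⟨u, by simp [Relation.ReflTransGen.refl]⟩
    simp only [Finset.mem_filter, Finset.mem_univ, true_and] at hx hx'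
    rcases hx.1.cases_head with rfl | ⟨c, hxc, hcu⟩
    · exact hx' v ⟨hvu, .single hdir⟩ hdir
    · exact hx' c ⟨hcu, hx.2.tail hxc⟩ hxc
  · intro c
    set A : Finset S := c.supp.toFinset with hAdef
    have hmem : ∀ x, x ∈ A ↔ (G.induce S).connectedComponentMk x = c := by
      intro x
      simp [hAdef]
    have hadj : ∀ x y, x ∈ A → (G.induce S).Adj x y → y ∈ A := by
      intro x y hx hxy
      rw [hmem] at hx ⊢
      rw [← hx]
      exact SimpleGraph.ConnectedComponent.sound hxy.symm.reachable
    obtain ⟨x, hxA, hx⟩ := hexit A (by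
      obtain ⟨v, hv⟩ := c.nonempty_supp
      exact ⟨v, by simpa [hAdef] using hv⟩)
    have harc : ∀ y, ¬ D.arcOn S x y := fun y h =>
      hx y (hadj x y hxA (D.adj_of_dir _ _ h)) h
    have hall : ∀ y ∈ A, Relation.ReflTransGen (D.arcOn S) y x := by
      intro y hy
      obtain ⟨p⟩ : (G.induce S).Reachable x y :=
        SimpleGraph.ConnectedComponent.exact (((hmem x).1 hxA).trans ((hmem y).1 hy).symm)
      have hclosed : ∀ a b, (G.induce S).Walk a b →
          Relation.ReflTransGen (D.arcOn S) a x → Relation.ReflTransGen (D.arcOn S) b x := by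
        intro a b p ha
        induction p with
        | nil => exact ha
        | cons h _ ih => exact ih (D.reflTransGen_of_adj hS ha h fun hax => hax ▸ harc _)
      exact hclosed x y p .refl
    have h := D.mul_card_le_of_isBEFlow hG hf hr (A := A.map (.subtype _)) (by
      intro x hx
      obtain ⟨y, -, rfl⟩ := Finset.mem_map.1 hx
      exact hS _ y.2)
    have hle : #{x ∈ A.map (.subtype _) | ∃ y, D.dir x y ∧ y ∉ A.map (.subtype _)} ≤ 1 := by
      rw [← Finset.card_singleton (x : V)]
      refine Finset.card_le_card fun z hz => ?_
      rw [Finset.mem_filter] at hz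
      obtain ⟨hzA, y, hzy, hy⟩ := hz
      obtain ⟨z, hz, rfl⟩ := Finset.mem_map.1 hzA
      rcases (hall z hz).cases_head with rfl | ⟨d, hzd, -⟩
      · exact Finset.mem_singleton_self _
      · rw [D.eq_of_dir_of_outDeg_eq_one (hS _ z.2) hzy hzd] at hy
        exact absurd (Finset.mem_map_of_mem _ (hadj z d hz (D.adj_of_dir _ _ hzd))) hy
    rw [Finset.card_map] at h
    have hle' : (r - 2) * (#{x ∈ A.map (.subtype _) | ∃ y, D.dir x y ∧ y ∉ A.map (.subtype _)} : ℝ)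
        ≤ r - 2 :=
      mul_le_of_le_one_right (by linarith) (by exact_mod_cast hle)
    have hpos : 0 < 1 - α := by linarith
    rw [div_lt_iff₀ hpos] at htr
    have hlt : (#A : ℝ) < k - 1 := by
      by_contra! hcon
      nlinarith
    have hlt' : #A + 1 < k := by
      have : ((#A + 1 : ℕ) : ℝ) < k := by
        push_cast
        linarith
      exact_mod_cast this
    rw [Set.ncard_eq_toFinset_card', ← hAdef]
    omega

theorem outDeg_eq_one_or_two (D : Orientation G) (hG : IsCubic G) {r α : ℝ} {f : Sym2 V → ℝ}
    (hf : IsBEFlow D r α f) (hα : α < 1) (x : V) : outDeg D x = 1 ∨ outDeg D x = 2 := by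
  have key : ∀ D : Orientation G, IsBEFlow D r α f → outDeg D x ≠ 0 := by
    intro D hf h0
    have h3 : outDeg D.reverse x = 3 := by
      have := D.outDeg_add_outDeg_reverse hG x
      omega
    rw [outDeg_eq_card] at h0 h3
    have h0' : ∀ y, ¬ D.dir x y := by simpa [Finset.filter_eq_empty_iff] using h0
    have hsum : (3 : ℝ) ≤ ∑ y : V, if D.dir y x then f s(x, y) else 0 := by
      rw [← Finset.sum_filter]
      calc (3 : ℝ) = ∑ y with D.dir y x, (1 : ℝ) := by
            have : #{y | D.dir y x} = 3 := h3
            simp [this]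
        _ ≤ _ := Finset.sum_le_sum fun y hy =>
            (hf.1 _ (D.adj_of_dir _ _ (Finset.mem_filter.1 hy).2).symm).1
    have := (abs_le.1 (hf.2 x)).1
    simp only [excess, h0', if_false, Finset.sum_const_zero] at this
    linarith
  have h1 := key D hf
  have h2 := key D.reverse (D.isBEFlow_reverse hf)
  have := D.outDeg_add_outDeg_reverse hG x
  omega

theorem ncard_outDeg_eq_one (D : Orientation G) (hG : IsCubic G)
    (hD : ∀ x, outDeg D x = 1 ∨ outDeg D x = 2) :
    {x | outDeg D x = 1}.ncard = {x | outDeg D x = 2}.ncard := by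
  have h0 := D.sum_excess (fun _ => 1) Finset.univ
  have h1 : ∀ x, excess D (fun _ => 1) x =
      (if outDeg D x = 2 then 1 else 0) - (if outDeg D x = 1 then 1 else 0) := by
    intro x
    have h3 := D.outDeg_add_outDeg_reverse hG x
    rw [excess_one]
    rcases hD x with h | h
    · have : outDeg D.reverse x = 2 := by omega
      norm_num [h, this]
    · have : outDeg D.reverse x = 1 := by omega
      norm_num [h, this]
  simp only [h1, Finset.sum_sub_distrib, Finset.sum_boole, Finset.compl_univ,
    Finset.filter_empty, Finset.card_empty, Nat.cast_zero, Finset.sum_const_zero, sub_self] at h0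
  have h2 : #{x | outDeg D x = 1} = #{x | outDeg D x = 2} := by
    have h2 := (sub_eq_zero.1 h0).symm
    exact_mod_cast h2
  rw [← Set.ncard_coe_finset, ← Set.ncard_coe_finset] at h2
  simpa using h2

/-- The excess at a vertex of outdegree one whose weight is one more than the total
weight of its in-neighbours. -/
theorem abs_excess_le (D : Orientation G) (hG : IsCubic G) {α m : ℝ} {a b : V → ℕ}
    {f : Sym2 V → ℝ} (hα : α ≤ 1) (hm : (1 - α) * (m - 1) ≤ 2 * α)
    (hf : ∀ u v, D.dir u v → f s(u, v) = 1 + (1 - α) * max (a u) (b v))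
    (ham : ∀ x, (a x : ℝ) ≤ m) (hbm : ∀ x, (b x : ℝ) ≤ m) {x : V} (hx : outDeg D x = 1)
    (hbx : b x = 0) (hax : a x = 1 + ∑ y with D.dir y x, a y) : |excess D f x| ≤ α := by
  have hrev : outDeg D.reverse x = 2 := by
    have := D.outDeg_add_outDeg_reverse hG x
    omega
  have hin : ∑ y : V, (if D.dir y x then f s(x, y) else 0) = 2 + (1 - α) * (a x - 1) := by
    have h2 : #{y | D.dir y x} = 2 := by rw [← hrev, outDeg_eq_card]; rfl
    rw [← Finset.sum_filter]
    calc _ = ∑ y with D.dir y x, (1 + (1 - α) * (a y : ℝ)) := by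
          refine Finset.sum_congr rfl fun y hy => ?_
          rw [Sym2.eq_swap, hf _ _ (Finset.mem_filter.1 hy).2, hbx]
          simp
      _ = _ := by
          rw [Finset.sum_add_distrib, ← Finset.mul_sum, hax]
          simp [h2]
  rw [outDeg_eq_card, Finset.card_eq_one] at hx
  obtain ⟨z, hz⟩ := hx
  have hxz : D.dir x z := by
    have : z ∈ ({y | D.dir x y} : Finset V) := by simp [hz]
    simpa using this
  have hout : ∑ y : V, (if D.dir x y then f s(x, y) else 0) = 1 + (1 - α) * max (a x) (b z) := by
    rw [← Finset.sum_filter, hz, Finset.sum_singleton, hf _ _ hxz]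
  have hlow : (a x : ℝ) ≤ max (a x : ℝ) (b z) := le_max_left _ _
  have hupp : max (a x : ℝ) (b z) ≤ m := max_le (ham x) (hbm z)
  have hone : (1 : ℝ) ≤ a x := by
    rw [hax]
    push_cast
    have : (0 : ℝ) ≤ ∑ y with D.dir y x, (a y : ℝ) := by positivity
    linarith
  rw [excess, hin, hout, abs_le, Nat.cast_max]
  constructor <;> nlinarith

end Orientation

theorem hasFlow_of_orientable [Fintype V] {G : SimpleGraph V} (hG : IsCubic G) {k : ℕ}
    (hk : 3 ≤ k) {V₁ V₂ : Set V} (hw : KWeak G k V₁ V₂) (ho : Orientable G V₁ V₂) :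
    HasFlow G (3 + ((k : ℝ) - 3) / ((k : ℝ) - 1)) (((k : ℝ) - 3) / ((k : ℝ) - 1)) := by
  obtain ⟨D, hD₁, hD₂⟩ := ho
  obtain ⟨⟨hdisj, hun, -⟩, hw₁, hw₂⟩ := hw
  have hk' : (3 : ℝ) ≤ k := by exact_mod_cast hk
  have hpos : (0 : ℝ) < k - 1 := by linarith
  set α : ℝ := ((k : ℝ) - 3) / ((k : ℝ) - 1) with hα
  have hβ : 1 - α = 2 / (k - 1) := by
    rw [hα]
    field_simp
    ring
  have hβ0 : 0 < 1 - α := by rw [hβ]; positivity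
  have hβk : (1 - α) * (k - 1) = 2 := by rw [hβ]; field_simp
  have hD₂' : ∀ v ∈ V₂, outDeg D.reverse v = 1 := by
    intro v hv
    have h1 := hD₂ v hv
    have h2 := D.outDeg_add_outDeg_reverse hG v
    omega
  set a : V → ℕ := fun x => #(D.ancestors V₁ x)
  set b : V → ℕ := fun x => #(D.reverse.ancestors V₂ x)
  have hcast : ((k - 2 : ℕ) : ℝ) = k - 2 := by
    rw [Nat.cast_sub (by omega)]
    norm_num
  have ha : ∀ x, (a x : ℝ) ≤ k - 2 := fun x => by
    rw [← hcast]
    exact_mod_cast D.card_ancestors_le hw₁ x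
  have hb : ∀ x, (b x : ℝ) ≤ k - 2 := fun x => by
    rw [← hcast]
    exact_mod_cast D.reverse.card_ancestors_le hw₂ x
  have hf : ∀ u v, D.dir u v →
      D.edgeFlow (1 - α) a b s(u, v) = 1 + (1 - α) * max (a u) (b v) :=
    fun u v => D.edgeFlow_of_dir _ _ _
  refine ⟨D, D.edgeFlow (1 - α) a b, ?_, fun x => ?_⟩
  · intro e he
    obtain ⟨u, v, rfl, huv⟩ : ∃ u v, e = s(u, v) ∧ D.dir u v := by
      induction e using Sym2.ind with
      | _ u v =>
        rcases D.dir_or_dir (show G.Adj u v from he) with h | h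
        · exact ⟨u, v, rfl, h⟩
        · exact ⟨v, u, Sym2.eq_swap, h⟩
    rw [hf _ _ huv, Nat.cast_max]
    have h0 : (0 : ℝ) ≤ max (a u : ℝ) (b v) := le_max_of_le_left (Nat.cast_nonneg _)
    have h1 : max (a u : ℝ) (b v) ≤ k - 2 := max_le (ha u) (hb v)
    constructor <;> nlinarith
  · rcases (show x ∈ V₁ ∪ V₂ by simp [hun]) with hx | hx
    · refine D.abs_excess_le hG (m := k - 2) (by linarith) (by linarith) hf ha hb (hD₁ x hx) ?_
        (D.card_ancestors hD₁ hw₁.1 hx)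
      simp [b, D.reverse.ancestors_eq_empty (Set.disjoint_left.1 hdisj hx)]
    · rw [← abs_neg, ← D.excess_reverse]
      refine D.reverse.abs_excess_le hG (m := k - 2) (by linarith) (by linarith) ?_ hb ha
        (hD₂' x hx) ?_ (D.reverse.card_ancestors hD₂' hw₂.1 hx)
      · intro u v huv
        rw [Sym2.eq_swap, hf v u huv, max_comm]
      · simp [a, D.ancestors_eq_empty (Set.disjoint_right.1 hdisj hx)]

theorem exists_kWeak_of_hasFlow [Fintype V] {G : SimpleGraph V} (hG : IsCubic G) {k : ℕ}
    (hk : 3 ≤ k) {r α : ℝ} (hr : 2 ≤ r) (hα : α < 1)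
    (htr : (r - 2 * α) / (1 - α) < (k : ℝ) + 1) (h : HasFlow G r α) :
    ∃ V₁ V₂ : Set V, KWeak G k V₁ V₂ ∧ Orientable G V₁ V₂ := by
  obtain ⟨D, f, hf⟩ := h
  have hD := D.outDeg_eq_one_or_two hG hf hα
  refine ⟨{x | outDeg D x = 1}, {x | outDeg D x = 2}, ⟨⟨?_, ?_, D.ncard_outDeg_eq_one hG hD⟩,
    D.weakSide_of_isBEFlow hG hf hr hα hk htr fun _ h => h,
    D.reverse.weakSide_of_isBEFlow hG (D.isBEFlow_reverse hf) hr hα hk htr fun v hv => ?_⟩,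
    D, fun _ h => h, fun _ h => h⟩
  · refine Set.disjoint_left.2 fun x (h1 : _ = 1) (h2 : _ = 2) => ?_
    omega
  · exact Set.eq_univ_of_forall hD
  · have h1 : outDeg D v = 2 := hv
    have h2 := D.outDeg_add_outDeg_reverse hG v
    omega

/-- equivalence of orientable `k`-weak bisections, the flow at the top of
`M_k`, and flows of trace `< k + 1`. -/
theorem stmt6 [Fintype V] (G : SimpleGraph V) (hG : IsCubic G)
    (k : ℕ) (hk : 3 ≤ k) :
    ((∃ V₁ V₂ : Set V, KWeak G k V₁ V₂ ∧ Orientable G V₁ V₂) ↔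
      HasFlow G (3 + ((k : ℝ) - 3) / ((k : ℝ) - 1)) (((k : ℝ) - 3) / ((k : ℝ) - 1))) ∧
    (HasFlow G (3 + ((k : ℝ) - 3) / ((k : ℝ) - 1)) (((k : ℝ) - 3) / ((k : ℝ) - 1)) ↔
      ∃ r α : ℝ, 2 ≤ r ∧ 0 ≤ α ∧ α < 1 ∧ (r - 2 * α) / (1 - α) < (k : ℝ) + 1 ∧
        HasFlow G r α) := by
  have hk' : (3 : ℝ) ≤ k := by exact_mod_cast hk
  have hpos : (0 : ℝ) < k - 1 := by linarith
  have hα0 : 0 ≤ ((k : ℝ) - 3) / ((k : ℝ) - 1) := div_nonneg (by linarith) hpos.le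
  have hα1 : ((k : ℝ) - 3) / ((k : ℝ) - 1) < 1 := by
    rw [div_lt_one hpos]
    linarith
  have htr : (3 + ((k : ℝ) - 3) / ((k : ℝ) - 1) - 2 * (((k : ℝ) - 3) / ((k : ℝ) - 1))) /
      (1 - ((k : ℝ) - 3) / ((k : ℝ) - 1)) < (k : ℝ) + 1 := by
    rw [div_lt_iff₀ (by linarith)]
    have hmul : ((k : ℝ) - 3) / ((k : ℝ) - 1) * (k - 1) = k - 3 := div_mul_cancel₀ _ hpos.ne'
    linarith
  refine ⟨⟨fun ⟨V₁, V₂, hw, ho⟩ => hasFlow_of_orientable hG hk hw ho, fun h =>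
    exists_kWeak_of_hasFlow hG hk (by linarith) hα1 htr h⟩,
    fun h => ⟨_, _, by linarith, hα0, hα1, htr, h⟩, ?_⟩
  rintro ⟨r, α, hr, -, hα, htr', h⟩
  obtain ⟨V₁, V₂, hw, ho⟩ := exists_kWeak_of_hasFlow hG hk hr hα htr' h
  exact hasFlow_of_orientable hG hk hw ho

end BEF
end

section
/- A cubic graph is bipartite if and only if it admits a (3,0)-flow, and in that case it admits an (r, 3−r)-flow for every real r with 2≤r≤3. -/
open Finset
open scoped Classical

namespace BEF

variable {V : Type*}

/-- The set of neighbours of a vertex of a cubic graph, as a finset, has three elements. -/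
theorem IsCubic.card_filter_adj [Fintype V] {G : SimpleGraph V} (hG : IsCubic G) (v : V) :
    #{w | G.Adj v w} = 3 := by
  rw [← hG v, ← Set.ncard_coe_finset]
  congr 1
  ext w
  simp

/-- A bipartite cubic graph has a perfect matching, given as an involution moving each vertex
to a neighbour. -/
theorem IsCubic.exists_involutive_adj [Fintype V] {G : SimpleGraph V} (hG : IsCubic G)
    {A : V → Prop} (hA : ∀ u v, G.Adj u v → (A u ↔ ¬ A v)) :
    ∃ p : V → V, Function.Involutive p ∧ ∀ v, G.Adj v (p v) := by
  obtain ⟨m, hinj, hm⟩ := (Finset.all_card_le_biUnion_card_iff_exists_injective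
    (fun v : V => ({w | G.Adj v w} : Finset V))).1 (by
      intro s
      have key := Finset.card_mul_le_card_mul (m := 3) (n := 3) G.Adj (s := s)
        (t := s.biUnion fun v => ({w | G.Adj v w} : Finset V))
        (fun a ha => by
          rw [← hG.card_filter_adj a]
          refine Finset.card_le_card fun w hw => ?_
          simp only [Finset.mem_filter, Finset.mem_univ, true_and] at hw
          simp only [Finset.mem_bipartiteAbove, Finset.mem_biUnion, Finset.mem_filter,
            Finset.mem_univ, true_and]
          exact ⟨⟨a, ha, hw⟩, hw⟩)
        (fun b _ => by
          rw [← hG.card_filter_adj b]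
          refine Finset.card_le_card fun w hw => ?_
          simp only [Finset.mem_bipartiteBelow] at hw
          simpa using hw.2.symm)
      omega)
  simp only [Finset.mem_filter, Finset.mem_univ, true_and] at hm
  let e : V ≃ V := Equiv.ofBijective m (Finite.injective_iff_bijective.1 hinj)
  have he : ∀ v, G.Adj v (e v) := hm
  have he' : ∀ v, G.Adj v (e.symm v) := fun v => by
    simpa using (he (e.symm v)).symm
  refine ⟨fun v => if A v then e v else e.symm v, fun v => ?_, fun v => ?_⟩
  · by_cases h : A v
    · have := (hA _ _ (he v)).1 h
      simp [h, this]
    · have : A (e.symm v) := by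
        by_contra h'
        exact h ((hA _ _ (he' v)).2 h')
      simp [h, this]
  · by_cases h : A v
    · simpa [h] using he v
    · simpa [h] using he' v

/-- A bipartite cubic graph admits an `(r, 3 - r)`-flow: the edges of a perfect matching carry
`r - 1` from one side to the other, and the remaining edges carry `1` back. -/
theorem IsCubic.hasFlow_of_colorable [Fintype V] {G : SimpleGraph V} (hG : IsCubic G)
    (hc : G.Colorable 2) {r : ℝ} (hr : 2 ≤ r) (hr' : r ≤ 3) : HasFlow G r (3 - r) := by
  obtain ⟨c⟩ := hc
  have hA : ∀ u v, G.Adj u v → (c u = 0 ↔ ¬ c v = 0) := fun u v h => by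
    have := c.valid h
    omega
  obtain ⟨p, hp, hadj⟩ := hG.exists_involutive_adj hA
  have hpc : ∀ u v, p u = v ↔ p v = u := fun u v =>
    ⟨fun h => h ▸ hp u, fun h => h ▸ hp v⟩
  let D : Orientation G :=
    { dir := fun u v => G.Adj u v ∧ (c u = 0 ↔ p u ≠ v)
      adj_of_dir := fun u v h => h.1
      dir_iff_not := fun u v h => by
        have h1 := hA u v h
        have h2 := hpc u v
        have h3 := h.symm
        tauto }
  let f : Sym2 V → ℝ := fun e => if ∃ x, e = s(x, p x) then r - 1 else 1
  have hf : ∀ x y, f s(x, y) = if p x = y then r - 1 else 1 := fun x y => by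
    have : (∃ z, s(x, y) = s(z, p z)) ↔ p x = y := by
      constructor
      · rintro ⟨z, hz⟩
        rcases Sym2.eq_iff.1 hz with ⟨rfl, rfl⟩ | ⟨rfl, rfl⟩
        · rfl
        · exact hp _
      · rintro rfl
        exact ⟨x, rfl⟩
    simp only [f, this]
  refine ⟨D, f, fun e _ => ?_, fun x => ?_⟩
  · simp only [f]
    split_ifs <;> constructor <;> linarith
  · have hout : ∀ y, D.dir x y ↔ G.Adj x y ∧ (c x = 0 ↔ p x ≠ y) := fun y => Iff.rfl
    have hin : ∀ y, D.dir y x ↔ G.Adj x y ∧ (c x = 0 ↔ p x = y) := fun y => by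
      have h1 := hA x y
      have h2 := hpc x y
      have h3 := G.adj_comm x y
      change G.Adj y x ∧ (c y = 0 ↔ p y ≠ x) ↔ _
      tauto
    have hmatch : (∑ y : V, if G.Adj x y ∧ p x = y then f s(x, y) else 0) = r - 1 := by
      rw [Finset.sum_eq_single (p x)]
      · simp [hadj x, hf]
      · intro y _ hy
        simp [hy.symm]
      · simp
    have hrest : (∑ y : V, if G.Adj x y ∧ p x ≠ y then f s(x, y) else 0) = 2 := by
      have hcard : #{y | G.Adj x y ∧ p x ≠ y} = 2 := by
        have : ({y | G.Adj x y ∧ p x ≠ y} : Finset V)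
            = ({y | G.Adj x y} : Finset V).erase (p x) := by
          ext y
          simp [and_comm, eq_comm]
        rw [this, Finset.card_erase_of_mem (by simpa using hadj x), hG.card_filter_adj]
      rw [← Finset.sum_filter, Finset.sum_congr rfl (g := fun _ => (1 : ℝ))]
      · simp [hcard]
      · intro y hy
        simp only [Finset.mem_filter] at hy
        simp [hf, hy.2.2]
    unfold excess
    by_cases hx : c x = 0
    · simp only [hout, hin, hx, true_iff]
      rw [hmatch, hrest, abs_le]
      constructor <;> linarith
    · simp only [hout, hin, hx, false_iff, not_not]
      rw [hmatch, hrest, abs_le]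
      constructor <;> linarith

/-- If three numbers in `[1, 2]` are distributed over `O` and `I` with equal sums, then the side
with a single number has it equal to `2`, and the other two are equal to `1`. -/
theorem eq_of_sum_eq_sum {α : Type*} {O I : Finset α} {f : α → ℝ} (hcard : #O + #I = 3)
    (hO : ∀ y ∈ O, 1 ≤ f y ∧ f y ≤ 2) (hI : ∀ y ∈ I, 1 ≤ f y ∧ f y ≤ 2)
    (hsum : ∑ y ∈ O, f y = ∑ y ∈ I, f y) :
    (∀ y ∈ O, f y = if #O = 1 then 2 else 1) ∧ ∀ y ∈ I, f y = if #O = 1 then 1 else 2 := by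
  have three : ∀ {S : Finset α}, (∀ y ∈ S, 1 ≤ f y ∧ f y ≤ 2) → #S = 3 → ∑ y ∈ S, f y ≠ 0 := by
    intro S hS h h0
    have := Finset.card_nsmul_le_sum S f 1 fun y hy => (hS y hy).1
    rw [h, h0] at this
    norm_num at this
  obtain h | h | h | h : #O = 0 ∨ #O = 1 ∨ #O = 2 ∨ #O = 3 := by omega
  · rw [Finset.card_eq_zero.1 h, Finset.sum_empty] at hsum
    exact absurd hsum.symm (three hI (by omega))
  · obtain ⟨a, rfl⟩ := Finset.card_eq_one.1 h
    obtain ⟨b, d, hbd, rfl⟩ := Finset.card_eq_two.1 (show #I = 2 by omega)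
    simp only [Finset.sum_singleton, Finset.sum_pair hbd] at hsum
    simp only [Finset.mem_singleton, Finset.mem_insert, forall_eq, forall_eq_or_imp] at hO hI
    simp only [Finset.card_singleton, if_true, Finset.mem_singleton, Finset.mem_insert, forall_eq,
      forall_eq_or_imp]
    refine ⟨?_, ?_, ?_⟩ <;> linarith
  · obtain ⟨b, d, hbd, rfl⟩ := Finset.card_eq_two.1 h
    obtain ⟨a, rfl⟩ := Finset.card_eq_one.1 (show #I = 1 by omega)
    simp only [Finset.sum_singleton, Finset.sum_pair hbd] at hsum
    simp only [Finset.mem_singleton, Finset.mem_insert, forall_eq, forall_eq_or_imp] at hO hI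
    simp only [h, OfNat.ofNat_ne_one, if_false, Finset.mem_singleton, Finset.mem_insert, forall_eq,
      forall_eq_or_imp]
    refine ⟨⟨?_, ?_⟩, ?_⟩ <;> linarith
  · rw [Finset.card_eq_zero.1 (show #I = 0 by omega), Finset.sum_empty] at hsum
    exact absurd hsum (three hO h)

/-- A cubic graph with a `(3, 0)`-flow is bipartite: colour a vertex according to whether its
outdegree is `1`. -/
theorem IsCubic.colorable_of_hasFlow [Fintype V] {G : SimpleGraph V} (hG : IsCubic G)
    (h : HasFlow G 3 0) : G.Colorable 2 := by
  obtain ⟨D, f, hf, hex⟩ := h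
  let O : V → Finset V := fun x => {y | D.dir x y}
  let I : V → Finset V := fun x => {y | D.dir y x}
  have key : ∀ x, (∀ y ∈ O x, f s(x, y) = if #(O x) = 1 then 2 else 1) ∧
      ∀ y ∈ I x, f s(x, y) = if #(O x) = 1 then 1 else 2 := by
    intro x
    have hb : ∀ y, G.Adj x y → 1 ≤ f s(x, y) ∧ f s(x, y) ≤ 2 := fun y hy => by
      have := hf s(x, y) hy
      constructor <;> linarith
    refine eq_of_sum_eq_sum (f := fun y => f s(x, y)) ?_ (fun y hy => hb y ?_)
      (fun y hy => hb y ?_) ?_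
    · rw [← hG.card_filter_adj x, ← Finset.card_union_of_disjoint]
      · congr 1
        ext y
        have h1 := D.adj_of_dir x y
        have h2 := D.adj_of_dir y x
        have h3 := D.dir_iff_not x y
        have h4 := G.adj_comm x y
        simp only [O, I, Finset.mem_union, Finset.mem_filter, Finset.mem_univ, true_and]
        tauto
      · refine Finset.disjoint_left.2 fun y hy hy' => ?_
        simp only [O, I, Finset.mem_filter, Finset.mem_univ, true_and] at hy hy'
        exact (D.dir_iff_not x y (D.adj_of_dir x y hy)).1 hy hy'
    · exact D.adj_of_dir x y (by simpa [O] using hy)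
    · exact (D.adj_of_dir y x (by simpa [I] using hy)).symm
    · have h0 := abs_nonpos_iff.1 (hex x)
      unfold excess at h0
      rw [← Finset.sum_filter, ← Finset.sum_filter] at h0
      exact sub_eq_zero.1 h0
  have hne : ∀ u v, D.dir u v → (#(O u) = 1) ≠ (#(O v) = 1) := by
    intro u v huv heq
    have h1 := (key u).1 v (by simpa [O] using huv)
    have h2 := (key v).2 u (by simpa [I] using huv)
    rw [Sym2.eq_swap, h1] at h2
    by_cases hu : #(O u) = 1
    · have hv := heq.mp hu
      norm_num [hu, hv] at h2
    · have hv : ¬ #(O v) = 1 := fun hv => hu (heq.mpr hv)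
      norm_num [hu, hv] at h2
  have C : G.Coloring Prop := SimpleGraph.Coloring.mk (fun x => #(O x) = 1) fun {u v} huv => by
    by_cases hd : D.dir u v
    · exact hne u v hd
    · exact (hne v u ((D.dir_iff_not v u huv.symm).2 hd)).symm
  simpa using C.colorable

/-- a cubic graph is bipartite iff it admits a `(3,0)`-flow, in which case
it admits an `(r, 3-r)`-flow for all `2 ≤ r ≤ 3`. -/
theorem stmt11 [Fintype V] (G : SimpleGraph V) (hG : IsCubic G) :
    (G.Colorable 2 ↔ HasFlow G 3 0) ∧
    (G.Colorable 2 → ∀ r : ℝ, 2 ≤ r → r ≤ 3 → HasFlow G r (3 - r)) := by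
  refine ⟨⟨fun h => ?_, hG.colorable_of_hasFlow⟩, fun h r => hG.hasFlow_of_colorable h⟩
  simpa using hG.hasFlow_of_colorable h (r := 3) (by norm_num) le_rfl

end BEF
end
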